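/- Let q_1, q_2 be real numbers with 1 < q_1 < 2 < q_2 and q_1 q_2 ((q_2 − 2) + q_2(q_1 − 2)) > 1. Then there exists ε > 0 such that for all spherically symmetric initial data φ_1^{(0)}, φ_2^{(0)} ∈ C², φ_1^{(1)}, φ_2^{(1)} ∈ C¹ supported in {|x| < 1} ⊂ ℝ³ with ‖φ_i^{(0)}‖_{W^{2,∞}} + ‖φ_i^{(1)}‖_{W^{1,∞}} ≤ ε, there exist continuous functions ψ_1, ψ_2 on {t ≥ 0, r ≥ 0} (with ψ_1 having a continuous time derivative and ψ_2 a continuous null derivative ∂_vψ_2) satisfying the Duhamel integral equations ψ_1(t,r) = ψ_1^{lin}(t,r) + (1/2)∬_{D_{t,r}} (r')^{1−q_1} |ψ_2(t',r')|^{q_1} dr' dt' and ψ_2(t,r) = ψ_2^{lin}(t,r) + (1/2)∬_{D_{t,r}} (r')^{1−q_2} |∂_tψ_1(t',r')|^{q_2} dr' dt', where ψ_i^{lin} is the free radial wave evolution of the data (φ_i^{(0)}, φ_i^{(1)}); moreover ‖(ψ_1, ψ_2)‖_X ≤ C·ε for a constant C depending only on q_1, q_2. In particular the radial functions φ_i =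 ψ_i / r are global solutions of the Glassey–Strauss system in the Duhamel sense. -/

import Mathlib

open Real Set MeasureTheory

noncomputable section

/-- Three-dimensional Euclidean space. -/
abbrev E3 : Type := EuclideanSpace ℝ (Fin 3)

/-- A function on `ℝ³` is radial (spherically symmetric) if it depends only on `|x|`. -/
def Radial (f : E3 → ℝ) : Prop := ∀ x y : E3, ‖x‖ = ‖y‖ → f x = f y

/-- Radial representative: value of `f` at the point at distance `r` on the first axis. -/
def radRep (f : E3 → ℝ) : ℝ → ℝ := fun r => f (r • EuclideanSpace.single (0 : Fin 3) (1 : ℝ))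

/-- `W^{2,∞}` norm: sup of the function and of its first and second Fréchet derivatives. -/
def W2inf (f : E3 → ℝ) : ℝ :=
  (⨆ x : E3, |f x|) + (⨆ x : E3, ‖fderiv ℝ f x‖) + (⨆ x : E3, ‖fderiv ℝ (fderiv ℝ f) x‖)

/-- `W^{1,∞}` norm: sup of the function and of its first Fréchet derivative. -/
def W1inf (f : E3 → ℝ) : ℝ :=
  (⨆ x : E3, |f x|) + (⨆ x : E3, ‖fderiv ℝ f x‖)

/-- Partial derivative in time of a function of `(t, r)`. -/
def pdt (ψ : ℝ → ℝ → ℝ) : ℝ → ℝ → ℝ := fun t r => deriv (fun s => ψ s r) t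

/-- Partial derivative in the radial variable of a function of `(t, r)`. -/
def pdr (ψ : ℝ → ℝ → ℝ) : ℝ → ℝ → ℝ := fun t r => deriv (fun ρ => ψ t ρ) r

/-- Outgoing null derivative `∂_v = ∂_t + ∂_r`. -/
def pdv (ψ : ℝ → ℝ → ℝ) : ℝ → ℝ → ℝ := fun t r => pdt ψ t r + pdr ψ t r

/-- Japanese bracket `⟨x⟩ = (1 + x²)^{1/2}`. -/
def jap (x : ℝ) : ℝ := Real.sqrt (1 + x ^ 2)

/-- The weighted sup-norm `X` for the Glassey–Strauss system: with `u = (t-r)/2`,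
`v = (t+r)/2`, it is
`sup |∂_tψ₁/r|⟨v⟩^{1+a}⟨u⟩^{s₁+1-a} + sup |ψ₂/r|⟨v⟩⟨u⟩^{s₂} + sup |∂_vψ₂|⟨v⟩^{s₂+1}`,
all sups taken over `{t ≥ 0, r ≥ 0}`. -/
def Xnorm (a s1 s2 : ℝ) (ψ1 ψ2 : ℝ → ℝ → ℝ) : ℝ :=
  (⨆ p : {p : ℝ × ℝ // 0 ≤ p.1 ∧ 0 ≤ p.2},
      |pdt ψ1 p.1.1 p.1.2 / p.1.2| * jap ((p.1.1 + p.1.2) / 2) ^ (1 + a)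
        * jap ((p.1.1 - p.1.2) / 2) ^ (s1 + 1 - a)) +
  (⨆ p : {p : ℝ × ℝ // 0 ≤ p.1 ∧ 0 ≤ p.2},
      |ψ2 p.1.1 p.1.2 / p.1.2| * jap ((p.1.1 + p.1.2) / 2)
        * jap ((p.1.1 - p.1.2) / 2) ^ s2) +
  (⨆ p : {p : ℝ × ℝ // 0 ≤ p.1 ∧ 0 ≤ p.2},
      |pdv ψ2 p.1.1 p.1.2| * jap ((p.1.1 + p.1.2) / 2) ^ (s2 + 1))

/-- Free radial wave evolution of radial data `(f0, f1)` on `ℝ³`, written for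
`ψ = r·φ` via d'Alembert's formula with the odd extensions `g(ρ) = ρ·f0(|ρ|)`,
`h(ρ) = ρ·f1(|ρ|)`. -/
def psiLin (f0 f1 : E3 → ℝ) : ℝ → ℝ → ℝ := fun t r =>
  ((r + t) * radRep f0 (r + t) + (r - t) * radRep f0 (r - t)) / 2
    + (1 / 2) * ∫ ρ in (r - t)..(r + t), ρ * radRep f1 ρ

/-- The backward characteristic region `D_{t,r}` in the `(t', r')` quadrant. -/
def Dreg (t r : ℝ) : Set (ℝ × ℝ) :=
  {p | 0 ≤ p.1 ∧ p.1 ≤ t ∧ 0 ≤ p.2 ∧ t - r ≤ p.1 + p.2 ∧ p.1 + p.2 ≤ t + r ∧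
    p.1 - p.2 ≤ t - r}

open Filter Topology Function

/-- The outgoing derivative of the wave with data `k` and source `G`: `k` plus the integral of the
source along the incoming ray `t + r = x`. -/
def ray (k : ℝ → ℝ) (G : ℝ → ℝ → ℝ) (x t : ℝ) : ℝ := k x + ∫ s in (0:ℝ)..t, G s (x - s)

/-- The solution of the one-dimensional wave equation with null data `k` and source `G`. -/
def wave (k : ℝ → ℝ) (G : ℝ → ℝ → ℝ) (t r : ℝ) : ℝ :=
  (∫ x in (t - r)..(t + r), k x) / 2
    + (∫ s in (0:ℝ)..t, ∫ ρ in (t - r - s)..(t + r - s), G s ρ) / 2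

/-- The time derivative of `wave k G`. -/
def vel (k : ℝ → ℝ) (G : ℝ → ℝ → ℝ) (t r : ℝ) : ℝ :=
  (ray k G (t + r) t - ray k G (t - r) t) / 2

lemma continuous_primitive_param {G : ℝ → ℝ → ℝ} (hG : Continuous (uncurry G)) :
    Continuous fun p : ℝ × ℝ => ∫ ρ in (0:ℝ)..p.2, G p.1 ρ :=
  intervalIntegral.continuous_parametric_primitive_of_continuous hG

lemma continuous_ray {k : ℝ → ℝ} {G : ℝ → ℝ → ℝ} (hk : Continuous k)
    (hG : Continuous (uncurry G)) : Continuous fun p : ℝ × ℝ => ray k G p.1 p.2 := by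
  unfold ray
  refine (hk.comp continuous_fst).add ?_
  refine intervalIntegral.continuous_parametric_intervalIntegral_of_continuous
    (f := fun (p : ℝ × ℝ) s => G s (p.1 - s)) ?_ continuous_snd
  exact hG.comp (by fun_prop : Continuous fun q : (ℝ × ℝ) × ℝ => (q.2, q.1.1 - q.2))

lemma continuous_vel {k : ℝ → ℝ} {G : ℝ → ℝ → ℝ} (hk : Continuous k)
    (hG : Continuous (uncurry G)) : Continuous fun p : ℝ × ℝ => vel k G p.1 p.2 := by
  unfold vel
  have h := continuous_ray hk hG
  exact ((h.comp (by fun_prop : Continuous fun p : ℝ × ℝ => (p.1 + p.2, p.1))).sub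
    (h.comp (by fun_prop : Continuous fun p : ℝ × ℝ => (p.1 - p.2, p.1)))).div_const 2

lemma hasStrictFDerivAt_double_primitive {G : ℝ → ℝ → ℝ} (hG : Continuous (uncurry G))
    (p : ℝ × ℝ) :
    HasStrictFDerivAt (fun p : ℝ × ℝ => ∫ s in (0:ℝ)..p.1, ∫ ρ in (0:ℝ)..(p.2 - s), G s ρ)
      (((1 : ℝ →L[ℝ] ℝ).smulRight (∫ ρ in (0:ℝ)..(p.2 - p.1), G p.1 ρ)).coprod
        ((1 : ℝ →L[ℝ] ℝ).smulRight (∫ s in (0:ℝ)..p.1, G s (p.2 - s)))) p := by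
  have hH := continuous_primitive_param hG
  have hR : Continuous fun p : ℝ × ℝ => ∫ s in (0:ℝ)..p.1, G s (p.2 - s) := by
    have := (continuous_ray (k := fun _ => 0) continuous_const hG).comp continuous_swap
    simpa [ray, Function.comp_def] using this
  refine hasStrictFDerivAt_uncurry_coprod
    (f := fun t x => ∫ s in (0:ℝ)..t, ∫ ρ in (0:ℝ)..(x - s), G s ρ)
    (f₁ := fun t x => (1 : ℝ →L[ℝ] ℝ).smulRight (∫ ρ in (0:ℝ)..(x - t), G t ρ))
    (f₂ := fun t x => (1 : ℝ →L[ℝ] ℝ).smulRight (∫ s in (0:ℝ)..t, G s (x - s)))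
    (Eventually.of_forall fun v => ?_) (Eventually.of_forall fun v => ?_) ?_ ?_
  · have hc : Continuous fun s => ∫ ρ in (0:ℝ)..(v.2 - s), G s ρ :=
      hH.comp (by fun_prop : Continuous fun s : ℝ => (s, v.2 - s))
    exact (intervalIntegral.integral_hasDerivAt_right (hc.intervalIntegrable _ _)
      hc.stronglyMeasurable.stronglyMeasurableAtFilter hc.continuousAt).hasFDerivAt
  · have hc : Continuous fun x => ∫ s in (0:ℝ)..v.1, G s (x - s) :=
      hR.comp (by fun_prop : Continuous fun x : ℝ => (v.1, x))
    have h1 : ∀ x, ∫ s in (0:ℝ)..v.1, ∫ ρ in (0:ℝ)..(x - s), G s ρ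
        = (∫ x' in (0:ℝ)..x, ∫ s in (0:ℝ)..v.1, G s (x' - s))
          + ∫ s in (0:ℝ)..v.1, ∫ ρ in (0:ℝ)..(-s), G s ρ := by
      intro x
      have hsw : (∫ x' in (0:ℝ)..x, ∫ s in (0:ℝ)..v.1, G s (x' - s))
          = ∫ s in (0:ℝ)..v.1, ∫ x' in (0:ℝ)..x, G s (x' - s) := by
        apply MeasureTheory.intervalIntegral_intervalIntegral_swap
        have hc2 : Continuous (uncurry fun x' s => G s (x' - s)) :=
          hG.comp (by fun_prop : Continuous fun q : ℝ × ℝ => (q.2, q.1 - q.2))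
        exact (hc2.continuousOn.integrableOn_compact (isCompact_uIcc.prod isCompact_uIcc)).mono_set
          (Set.prod_mono uIoc_subset_uIcc uIoc_subset_uIcc)
      rw [hsw, ← intervalIntegral.integral_add]
      · refine intervalIntegral.integral_congr fun s _ => ?_
        have hGs : Continuous (G s) := hG.comp (by fun_prop : Continuous fun ρ : ℝ => (s, ρ))
        simp only [intervalIntegral.integral_comp_sub_right (fun ρ => G s ρ), zero_sub]
        rw [add_comm, intervalIntegral.integral_add_adjacent_intervals] <;>
          exact hGs.intervalIntegrable _ _
      · refine Continuous.intervalIntegrable ?_ _ _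
        refine intervalIntegral.continuous_parametric_intervalIntegral_of_continuous'
          (f := fun s x' => G s (x' - s)) ?_ 0 x
        exact hG.comp (by fun_prop : Continuous fun q : ℝ × ℝ => (q.1, q.2 - q.1))
      · refine Continuous.intervalIntegrable ?_ _ _
        exact hH.comp (by fun_prop : Continuous fun s : ℝ => (s, -s))
    have h2 := (intervalIntegral.integral_hasDerivAt_right (hc.intervalIntegrable 0 v.2)
      hc.stronglyMeasurable.stronglyMeasurableAtFilter hc.continuousAt).add_const
      (∫ s in (0:ℝ)..v.1, ∫ ρ in (0:ℝ)..(-s), G s ρ)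
    simp only [h1]
    exact h2.hasFDerivAt
  · have : Continuous fun p : ℝ × ℝ => ∫ ρ in (0:ℝ)..(p.2 - p.1), G p.1 ρ :=
      hH.comp (by fun_prop : Continuous fun p : ℝ × ℝ => (p.1, p.2 - p.1))
    exact ((ContinuousLinearMap.smulRightL ℝ ℝ ℝ 1).continuous.comp this).continuousAt
  · exact ((ContinuousLinearMap.smulRightL ℝ ℝ ℝ 1).continuous.comp hR).continuousAt

lemma intervalIntegral_odd {f : ℝ → ℝ} (hodd : ∀ ρ, f (-ρ) = -f ρ) (a : ℝ) :
    ∫ ρ in (-a)..a, f ρ = 0 := by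
  have h := intervalIntegral.integral_comp_neg (a := -a) (b := a) f
  simp only [hodd, intervalIntegral.integral_neg, neg_neg] at h
  linarith

lemma primitive_even {f : ℝ → ℝ} (hf : Continuous f) (hodd : ∀ ρ, f (-ρ) = -f ρ) (a : ℝ) :
    ∫ ρ in (0:ℝ)..(-a), f ρ = ∫ ρ in (0:ℝ)..a, f ρ := by
  have h := intervalIntegral_odd hodd a
  rw [← intervalIntegral.integral_add_adjacent_intervals (b := 0) (hf.intervalIntegrable _ _)
    (hf.intervalIntegrable _ _), intervalIntegral.integral_symm 0 (-a)] at h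
  linarith

lemma wave_eq_primitive {k : ℝ → ℝ} {G : ℝ → ℝ → ℝ} (hk : Continuous k)
    (hG : Continuous (uncurry G)) (t r : ℝ) :
    wave k G t r = ((∫ x in (0:ℝ)..(t + r), k x) - (∫ x in (0:ℝ)..(t - r), k x)) / 2
      + ((∫ s in (0:ℝ)..t, ∫ ρ in (0:ℝ)..(t + r - s), G s ρ)
        - (∫ s in (0:ℝ)..t, ∫ ρ in (0:ℝ)..(t - r - s), G s ρ)) / 2 := by
  have hH := continuous_primitive_param hG
  have hc : ∀ x, Continuous fun s => ∫ ρ in (0:ℝ)..(x - s), G s ρ := fun x =>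
    hH.comp (by fun_prop : Continuous fun s : ℝ => (s, x - s))
  unfold wave
  rw [intervalIntegral.integral_interval_sub_left (hk.intervalIntegrable _ _)
    (hk.intervalIntegrable _ _), ← intervalIntegral.integral_sub
      ((hc _).intervalIntegrable _ _) ((hc _).intervalIntegrable _ _)]
  congr 2
  refine intervalIntegral.integral_congr fun s _ => ?_
  have hGs : Continuous (G s) := hG.comp (by fun_prop : Continuous fun ρ : ℝ => (s, ρ))
  exact (intervalIntegral.integral_interval_sub_left (hGs.intervalIntegrable _ _)
    (hGs.intervalIntegrable _ _)).symm

lemma continuous_wave {k : ℝ → ℝ} {G : ℝ → ℝ → ℝ} (hk : Continuous k)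
    (hG : Continuous (uncurry G)) : Continuous fun p : ℝ × ℝ => wave k G p.1 p.2 := by
  simp only [wave_eq_primitive hk hG]
  have h1 : Continuous fun x => ∫ x in (0:ℝ)..x, k x :=
    intervalIntegral.continuous_primitive (fun _ _ => hk.intervalIntegrable _ _) 0
  have h2 : Continuous fun p : ℝ × ℝ => ∫ s in (0:ℝ)..p.1, ∫ ρ in (0:ℝ)..(p.2 - s), G s ρ :=
    continuous_iff_continuousAt.2 fun p =>
      (hasStrictFDerivAt_double_primitive hG p).hasFDerivAt.continuousAt
  have e1 : Continuous fun p : ℝ × ℝ => p.1 + p.2 := by fun_prop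
  have e2 : Continuous fun p : ℝ × ℝ => p.1 - p.2 := by fun_prop
  exact (((h1.comp e1).sub (h1.comp e2)).div_const 2).add
    (((h2.comp (continuous_fst.prodMk e1)).sub (h2.comp (continuous_fst.prodMk e2))).div_const 2)

lemma hasDerivAt_wave {k : ℝ → ℝ} {G : ℝ → ℝ → ℝ} (hk : Continuous k)
    (hG : Continuous (uncurry G)) (hodd : ∀ s ρ, G s (-ρ) = -G s ρ) {a b : ℝ → ℝ} {a' b' τ : ℝ}
    (ha : HasDerivAt a a' τ) (hb : HasDerivAt b b' τ) :
    HasDerivAt (fun σ => wave k G (a σ) (b σ))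
      ((ray k G (a τ + b τ) (a τ) * (a' + b') - ray k G (a τ - b τ) (a τ) * (a' - b')) / 2) τ := by
  simp only [wave_eq_primitive hk hG]
  have hK : ∀ {c : ℝ → ℝ} {c' : ℝ}, HasDerivAt c c' τ →
      HasDerivAt (fun σ => ∫ x in (0:ℝ)..(c σ), k x) (k (c τ) * c') τ := fun {c c'} hc =>
    (intervalIntegral.integral_hasDerivAt_right (hk.intervalIntegrable 0 (c τ))
      hk.stronglyMeasurable.stronglyMeasurableAtFilter hk.continuousAt).comp τ hc
  have hL : ∀ {c : ℝ → ℝ} {c' : ℝ}, HasDerivAt c c' τ →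
      HasDerivAt (fun σ => ∫ s in (0:ℝ)..(a σ), ∫ ρ in (0:ℝ)..(c σ - s), G s ρ)
        (a' * (∫ ρ in (0:ℝ)..(c τ - a τ), G (a τ) ρ)
          + c' * ∫ s in (0:ℝ)..(a τ), G s (c τ - s)) τ := by
    intro c c' hc
    have := (hasStrictFDerivAt_double_primitive hG (a τ, c τ)).hasFDerivAt.comp_hasDerivAt τ
      (ha.prodMk hc)
    exact this.congr_deriv (by simp)
  have he : ∫ ρ in (0:ℝ)..(-b τ), G (a τ) ρ = ∫ ρ in (0:ℝ)..(b τ), G (a τ) ρ :=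
    primitive_even (hG.comp (by fun_prop : Continuous fun ρ : ℝ => (a τ, ρ))) (hodd _) _
  have h1 := hL (ha.add hb)
  have h2 := hL (ha.sub hb)
  have h3 := (((hK (ha.add hb)).sub (hK (ha.sub hb))).div_const 2).add ((h1.sub h2).div_const 2)
  refine h3.congr_deriv ?_
  simp only [Pi.add_apply, Pi.sub_apply, add_sub_cancel_left, sub_sub_cancel_left, he, ray]
  ring

lemma hasDerivAt_wave_time {k : ℝ → ℝ} {G : ℝ → ℝ → ℝ} (hk : Continuous k)
    (hG : Continuous (uncurry G)) (hodd : ∀ s ρ, G s (-ρ) = -G s ρ) (t r : ℝ) :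
    HasDerivAt (fun τ => wave k G τ r) (vel k G t r) t :=
  (hasDerivAt_wave hk hG hodd (hasDerivAt_id t) (hasDerivAt_const t r)).congr_deriv
    (by simp [vel])

lemma pdt_wave {k : ℝ → ℝ} {G : ℝ → ℝ → ℝ} (hk : Continuous k)
    (hG : Continuous (uncurry G)) (hodd : ∀ s ρ, G s (-ρ) = -G s ρ) (t r : ℝ) :
    pdt (wave k G) t r = vel k G t r :=
  (hasDerivAt_wave_time hk hG hodd t r).deriv

lemma pdv_wave {k : ℝ → ℝ} {G : ℝ → ℝ → ℝ} (hk : Continuous k)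
    (hG : Continuous (uncurry G)) (hodd : ∀ s ρ, G s (-ρ) = -G s ρ) (t r : ℝ) :
    pdv (wave k G) t r = ray k G (t + r) t := by
  have h : pdr (wave k G) t r = _ :=
    (hasDerivAt_wave hk hG hodd (hasDerivAt_const r t) (hasDerivAt_id r)).deriv
  rw [pdv, pdt_wave hk hG hodd, h, vel]
  simp only [id]
  ring

lemma wave_sub_wave {k : ℝ → ℝ} {G : ℝ → ℝ → ℝ} (hk : Continuous k)
    (hG : Continuous (uncurry G)) (hodd : ∀ s ρ, G s (-ρ) = -G s ρ) (t r d : ℝ) :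
    wave k G (t + d) (r + d) - wave k G t r
      = ∫ τ in (0:ℝ)..d, ray k G (t + r + 2 * τ) (t + τ) := by
  have hc : Continuous fun τ => ray k G (t + r + 2 * τ) (t + τ) :=
    (continuous_ray hk hG).comp (by fun_prop : Continuous fun τ : ℝ => (t + r + 2 * τ, t + τ))
  rw [intervalIntegral.integral_eq_sub_of_hasDerivAt
    (f := fun τ => wave k G (t + τ) (r + τ)) (fun τ _ => ?_) (hc.intervalIntegrable _ _)]
  · simp
  · refine (hasDerivAt_wave hk hG hodd ((hasDerivAt_id τ).const_add t)
      ((hasDerivAt_id τ).const_add r)).congr_deriv ?_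
    simp only [id]
    rw [show t + τ + (r + τ) = t + r + 2 * τ by ring]
    ring

lemma wave_neg (k : ℝ → ℝ) (G : ℝ → ℝ → ℝ) (t r : ℝ) : wave k G t (-r) = -wave k G t r := by
  unfold wave
  simp only [sub_neg_eq_add, ← sub_eq_add_neg]
  rw [intervalIntegral.integral_symm (t - r)]
  have h : ∀ s, ∫ ρ in (t + r - s)..(t - r - s), G s ρ
      = -∫ ρ in (t - r - s)..(t + r - s), G s ρ := fun s => intervalIntegral.integral_symm _ _
  simp only [h, intervalIntegral.integral_neg]
  ring

lemma vel_neg (k : ℝ → ℝ) (G : ℝ → ℝ → ℝ) (t r : ℝ) : vel k G t (-r) = -vel k G t r := by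
  unfold vel
  simp only [sub_neg_eq_add, ← sub_eq_add_neg]
  ring

/-- Reflecting the part of the dependence domain with negative radius. -/
lemma intervalIntegral_reflect {f : ℝ → ℝ} (hf : Continuous f) (hodd : ∀ ρ, f (-ρ) = -f ρ)
    (a b : ℝ) : ∫ ρ in (-a)..b, f ρ = ∫ ρ in a..b, f ρ := by
  rw [← intervalIntegral.integral_interval_sub_left (hf.intervalIntegrable 0 _)
    (hf.intervalIntegrable 0 _), ← intervalIntegral.integral_interval_sub_left
    (hf.intervalIntegrable 0 b) (hf.intervalIntegrable 0 a), primitive_even hf hodd]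

lemma wave_eq_domain {k : ℝ → ℝ} {G : ℝ → ℝ → ℝ}
    (hG : Continuous (uncurry G)) (hodd : ∀ s ρ, G s (-ρ) = -G s ρ) (t r : ℝ) :
    wave k G t r = (∫ x in (t - r)..(t + r), k x) / 2
      + (∫ s in (0:ℝ)..t, ∫ ρ in |t - r - s|..(t + r - s), G s ρ) / 2 := by
  unfold wave
  congr 2
  refine intervalIntegral.integral_congr fun s _ => ?_
  have hGs : Continuous (G s) := hG.comp (by fun_prop : Continuous fun ρ : ℝ => (s, ρ))
  rcases abs_cases (t - r - s) with ⟨h, _⟩ | ⟨h, _⟩ <;> simp only [h]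
  exact (by simpa using intervalIntegral_reflect hGs (hodd s) (-(t - r - s)) (t + r - s))

lemma isClosed_Dreg (t r : ℝ) : IsClosed (Dreg t r) := by
  simp only [Dreg, Set.ofPred_and]
  refine .inter ?_ <| .inter ?_ <| .inter ?_ <| .inter ?_ <| .inter ?_ ?_ <;>
    exact isClosed_le (by fun_prop) (by fun_prop)

lemma setIntegral_Dreg {G : ℝ → ℝ → ℝ} (hG : Continuous (uncurry G)) {t r : ℝ} (ht : 0 ≤ t)
    (hr : 0 ≤ r) : ∫ p in Dreg t r, G p.1 p.2
      = ∫ s in (0:ℝ)..t, ∫ ρ in |t - r - s|..(t + r - s), G s ρ := by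
  have hcl := isClosed_Dreg t r
  have hsub : Dreg t r ⊆ Set.Icc 0 t ×ˢ Set.Icc 0 (t + r) := by
    rintro ⟨s, ρ⟩ ⟨h1, h2, h3, h4, h5, h6⟩
    simp only at h1 h2 h3 h4 h5 h6
    exact ⟨⟨h1, h2⟩, ⟨h3, by linarith⟩⟩
  have hcomp : IsCompact (Dreg t r) := (isCompact_Icc.prod isCompact_Icc).of_isClosed_subset hcl hsub
  have hGint : IntegrableOn (fun p : ℝ × ℝ => G p.1 p.2) (Dreg t r) :=
    (hG.continuousOn (s := Dreg t r)).integrableOn_compact hcomp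
  rw [← integral_indicator hcl.measurableSet, Measure.volume_eq_prod,
    integral_prod _ (by
      rw [← Measure.volume_eq_prod]; exact hGint.integrable_indicator hcl.measurableSet),
    intervalIntegral.integral_of_le ht, ← integral_Icc_eq_integral_Ioc,
    ← integral_indicator measurableSet_Icc]
  refine integral_congr_ae (Eventually.of_forall fun s => ?_)
  by_cases hs : s ∈ Set.Icc 0 t
  · simp only [Set.indicator_of_mem hs]
    have hle : |t - r - s| ≤ t + r - s := abs_le.2 ⟨by linarith [hs.2], by linarith⟩
    rw [intervalIntegral.integral_of_le hle, ← integral_Icc_eq_integral_Ioc,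
      ← integral_indicator measurableSet_Icc]
    refine integral_congr_ae (Eventually.of_forall fun ρ => ?_)
    have hiff : (s, ρ) ∈ Dreg t r ↔ ρ ∈ Set.Icc |t - r - s| (t + r - s) := by
      constructor
      · rintro ⟨h1, h2, h3, h4, h5, h6⟩
        simp only at h1 h2 h3 h4 h5 h6
        exact ⟨abs_le.2 ⟨by linarith, by linarith⟩, by linarith⟩
      · rintro ⟨h1, h2⟩
        obtain ⟨h3, h4⟩ := abs_le.1 h1
        exact ⟨hs.1, hs.2, (abs_nonneg _).trans h1, by simp only; linarith, by simp only; linarith,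
          by simp only; linarith⟩
    by_cases hρ : (s, ρ) ∈ Dreg t r
    · simp [Set.indicator_of_mem hρ, Set.indicator_of_mem (hiff.1 hρ)]
    · simp [Set.indicator_of_notMem hρ, Set.indicator_of_notMem (mt hiff.2 hρ)]
  · simp only [Set.indicator_of_notMem hs]
    have : ∀ ρ, (s, ρ) ∉ Dreg t r := fun ρ h => hs ⟨h.1, h.2.1⟩
    simp [Set.indicator_of_notMem (this _)]

/-- The nonlinearity `r |φ|^q`, written in terms of `ψ = r φ`. -/
def nl (q ρ z : ℝ) : ℝ := ρ * |z / ρ| ^ q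

lemma nl_of_nonneg {q ρ z : ℝ} (hq : q ≠ 1) (hρ : 0 ≤ ρ) :
    nl q ρ z = ρ ^ (1 - q) * |z| ^ q := by
  unfold nl
  rcases hρ.eq_or_lt with rfl | hρ
  · rw [Real.zero_rpow (sub_ne_zero.2 hq.symm)]; simp
  · rw [abs_div, abs_of_pos hρ, Real.div_rpow (abs_nonneg _) hρ.le, Real.rpow_sub hρ, Real.rpow_one]
    ring

lemma nl_nonneg {q ρ z : ℝ} (hρ : 0 ≤ ρ) : 0 ≤ nl q ρ z := by unfold nl; positivity

lemma nl_zero_right {q ρ : ℝ} (hq : 0 < q) : nl q ρ 0 = 0 := by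
  simp [nl, Real.zero_rpow hq.ne']

lemma nl_neg_neg (q ρ z : ℝ) : nl q (-ρ) (-z) = -nl q ρ z := by simp [nl]

lemma abs_nl_le {q ρ z m : ℝ} (hq : 0 ≤ q) (hm : 0 ≤ m) (h : |z| ≤ m * |ρ|) :
    |nl q ρ z| ≤ |ρ| * m ^ q := by
  rw [nl, abs_mul, abs_of_nonneg (a := |z / ρ| ^ q) (by positivity)]
  gcongr
  rw [abs_div]
  exact div_le_of_le_mul₀ (abs_nonneg _) hm h

lemma abs_rpow_sub_rpow_le {q m a b : ℝ} (hq : 1 ≤ q) (ha : |a| ≤ m) (hb : |b| ≤ m) :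
    |(|a| ^ q - |b| ^ q)| ≤ q * m ^ (q - 1) * |a - b| := by
  have hm : 0 ≤ m := (abs_nonneg a).trans ha
  have key := (convex_Icc (0:ℝ) m).norm_image_sub_le_of_norm_hasDerivWithin_le
    (f := fun x => x ^ q) (f' := fun x => q * x ^ (q - 1)) (C := q * m ^ (q - 1))
    (fun x _ => (Real.hasDerivAt_rpow_const (Or.inr hq)).hasDerivWithinAt)
    (fun x hx => ?_) ⟨abs_nonneg b, hb⟩ ⟨abs_nonneg a, ha⟩
  · simp only [Real.norm_eq_abs] at key
    refine key.trans ?_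
    exact mul_le_mul_of_nonneg_left (abs_abs_sub_abs_le a b) (by positivity)
  · rw [Real.norm_eq_abs, abs_of_nonneg (by have := hx.1; positivity)]
    exact mul_le_mul_of_nonneg_left
      (Real.rpow_le_rpow hx.1 hx.2 (by linarith)) (by linarith)

lemma abs_nl_sub_nl_le {q ρ z w m : ℝ} (hq : 1 ≤ q) (hz : |z| ≤ m * |ρ|) (hw : |w| ≤ m * |ρ|) :
    |nl q ρ z - nl q ρ w| ≤ q * m ^ (q - 1) * |z - w| := by
  rcases eq_or_ne ρ 0 with rfl | hρ
  · simp only [abs_zero, mul_zero, abs_nonpos_iff] at hz hw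
    simp [nl, hz, hw]
  have hρ' := abs_pos.2 hρ
  have h := abs_rpow_sub_rpow_le hq (a := z / ρ) (b := w / ρ) (m := m)
    (by rw [abs_div]; exact (div_le_iff₀ hρ').2 hz) (by rw [abs_div]; exact (div_le_iff₀ hρ').2 hw)
  unfold nl
  rw [← mul_sub, abs_mul]
  calc _ ≤ |ρ| * (q * m ^ (q - 1) * |z / ρ - w / ρ|) := by gcongr
    _ = _ := by rw [← sub_div, abs_div]; field_simp

lemma abs_nl_radius_sub_le {q r₁ r₂ z₁ z₂ m m₂ : ℝ} (hq : 1 ≤ q) (hr₁ : 0 ≤ r₁) (hr : r₁ ≤ r₂)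
    (hm₂ : 0 ≤ m₂) (hm : m₂ ≤ m) (h₁ : |z₁| ≤ m * r₁) (h₂ : |z₂| ≤ m₂ * r₂) :
    |nl q r₂ z₂ - nl q r₁ z₁| ≤ 2 * q * m ^ (q - 1) * ((r₂ - r₁) * m₂ + |z₂ - z₁|) := by
  have hm0 : 0 ≤ m := hm₂.trans hm
  have hr2 := hr₁.trans hr
  set φ := z₂ / r₂ with hφ
  have hφ2 : |φ| ≤ m₂ := by
    rw [hφ, abs_div, abs_of_nonneg hr2]; exact div_le_of_le_mul₀ hr2 hm₂ h₂
  have hz2 : z₂ = r₂ * φ := by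
    rcases hr2.eq_or_lt with h | h
    · rw [← h] at h₂
      simpa [← h] using h₂
    · rw [hφ]; field_simp
  have e : nl q r₂ z₂ - nl q r₁ z₁ = (r₂ - r₁) * |φ| ^ q + (nl q r₁ (r₁ * φ) - nl q r₁ z₁) := by
    rcases hr₁.eq_or_lt with h | h
    · simp [nl, ← h, hφ]
    · have : r₁ * φ / r₁ = φ := by field_simp
      simp only [nl, this, ← hφ]; ring
  have hd := abs_nl_sub_nl_le (ρ := r₁) (z := r₁ * φ) (w := z₁) (m := m) hq
    (by rw [abs_mul, mul_comm]; gcongr; exact hφ2.trans hm) (by rwa [abs_of_nonneg hr₁])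
  have hp : |φ| ^ q ≤ m ^ (q - 1) * m₂ := by
    rcases (abs_nonneg φ).eq_or_lt with h | h
    · rw [← h, Real.zero_rpow (by linarith)]; positivity
    · rw [show |φ| ^ q = |φ| ^ (q - 1) * |φ| by
        rw [← Real.rpow_add_one h.ne', sub_add_cancel]]
      gcongr
      exact hφ2.trans hm
  have hdist : |r₁ * φ - z₁| ≤ |z₂ - z₁| + (r₂ - r₁) * m₂ := by
    rw [show r₁ * φ - z₁ = (z₂ - z₁) - (r₂ - r₁) * φ by rw [hz2]; ring]
    refine (abs_sub _ _).trans ?_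
    rw [abs_mul, abs_of_nonneg (sub_nonneg.2 hr)]
    gcongr
  have hA : 0 ≤ m ^ (q - 1) := by positivity
  have hD : 0 ≤ (r₂ - r₁) * m₂ := mul_nonneg (sub_nonneg.2 hr) hm₂
  rw [e]
  calc _ ≤ |(r₂ - r₁) * |φ| ^ q| + |nl q r₁ (r₁ * φ) - nl q r₁ z₁| := abs_add_le _ _
    _ ≤ (r₂ - r₁) * (m ^ (q - 1) * m₂) + q * m ^ (q - 1) * (|z₂ - z₁| + (r₂ - r₁) * m₂) := by
      rw [abs_mul, abs_of_nonneg (sub_nonneg.2 hr), abs_of_nonneg (by positivity : 0 ≤ |φ| ^ q)]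
      refine add_le_add (mul_le_mul_of_nonneg_left hp (sub_nonneg.2 hr)) (hd.trans ?_)
      gcongr
    _ ≤ _ := by
      have h1 : 0 ≤ (q - 1) * (m ^ (q - 1) * ((r₂ - r₁) * m₂)) :=
        mul_nonneg (by linarith) (by positivity)
      have h2 : 0 ≤ q * (m ^ (q - 1) * |z₂ - z₁|) := by positivity
      nlinarith

lemma continuous_nl {q M : ℝ} (hq : 0 < q) (hM : 0 ≤ M) {f : ℝ → ℝ → ℝ}
    (hf : Continuous (uncurry f)) (hb : ∀ s ρ, |f s ρ| ≤ M * |ρ|) :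
    Continuous (uncurry fun s ρ => nl q ρ (f s ρ)) := by
  rw [continuous_iff_continuousAt]
  rintro ⟨s, ρ⟩
  rcases eq_or_ne ρ 0 with rfl | hρ
  · have h0 : uncurry (fun s ρ => nl q ρ (f s ρ)) (s, 0) = 0 := by simp [nl]
    rw [ContinuousAt, h0]
    refine squeeze_zero_norm (a := fun p : ℝ × ℝ => |p.2| * M ^ q)
      (fun p => abs_nl_le hq.le hM (hb p.1 p.2)) ?_
    have : Continuous fun p : ℝ × ℝ => |p.2| * M ^ q := by fun_prop
    simpa using this.tendsto (s, 0)
  · have hz : ContinuousAt (fun p : ℝ × ℝ => |f p.1 p.2 / p.2|) (s, ρ) :=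
      ((hf.continuousAt (x := (s, ρ))).div continuousAt_snd hρ).abs
    exact continuousAt_snd.mul (hz.rpow_const (Or.inr hq.le))

lemma integral_one_add_rpow {e a b : ℝ} (he : e ≠ -1) (ha : 0 ≤ a) (hb : 0 ≤ b) :
    ∫ x in a..b, (1 + x) ^ e = ((1 + b) ^ (e + 1) - (1 + a) ^ (e + 1)) / (e + 1) := by
  rw [intervalIntegral.integral_comp_add_left (fun x => x ^ e), integral_rpow]
  refine Or.inr ⟨he, fun h => ?_⟩
  have := h.1
  rcases le_total (1 + a) (1 + b) with h | h
  · rw [inf_eq_left.2 h] at this; linarith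
  · rw [inf_eq_right.2 h] at this; linarith

lemma integral_one_add_rpow_le {e a b : ℝ} (he : -1 < e) (he' : e ≤ 0) (ha : 0 ≤ a) (hab : a ≤ b) :
    ∫ x in a..b, (1 + x) ^ e ≤ (b - a) * (1 + b) ^ e / (e + 1) := by
  rw [integral_one_add_rpow he.ne' ha (ha.trans hab)]
  have h1 : 0 < e + 1 := by linarith
  gcongr
  rw [Real.rpow_add_one (by linarith), Real.rpow_add_one (by linarith)]
  have : (1 + b) ^ e ≤ (1 + a) ^ e := Real.rpow_le_rpow_of_nonpos (by linarith) (by linarith) he'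
  nlinarith

lemma one_sub_rpow_le {s y : ℝ} (hs : 0 < s) (hy : 0 < y) (hy' : y ≤ 1) :
    (1 - y ^ s) / s ≤ (1 + 1 / s) * (1 - y) := by
  rw [div_le_iff₀ hs]
  rcases le_total 1 s with h | h
  · have := one_add_mul_self_le_rpow_one_add (s := y - 1) (by linarith) h
    rw [add_sub_cancel] at this
    have h2 : (1 + 1 / s) * (1 - y) * s = s * (1 - y) + (1 - y) := by field_simp
    nlinarith
  · have : y ≤ y ^ s := by
      simpa using Real.rpow_le_rpow_of_exponent_ge hy hy' h
    have h2 : (1 + 1 / s) * (1 - y) * s = s * (1 - y) + (1 - y) := by field_simp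
    nlinarith

lemma integral_one_add_rpow_neg_le {s a b : ℝ} (hs : 0 < s) (ha : 0 ≤ a) (hab : a ≤ b) :
    ∫ x in a..b, (1 + x) ^ (-1 - s)
      ≤ (1 + 1 / s) * ((b - a) * (1 + b)⁻¹ * (1 + a) ^ (-s)) := by
  have ha1 : 0 < 1 + a := by linarith
  have hb1 : 0 < 1 + b := by linarith
  rw [integral_one_add_rpow (by linarith) ha (ha.trans hab)]
  have h := one_sub_rpow_le hs (y := (1 + a) / (1 + b)) (by positivity)
    ((div_le_one hb1).2 (by linarith))
  have e1 : (1 + b) ^ (-1 - s + 1) = (1 + a) ^ (-s) * ((1 + a) / (1 + b)) ^ s := by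
    rw [Real.div_rpow ha1.le hb1.le, Real.rpow_neg ha1.le, show -1 - s + 1 = -s by ring,
      Real.rpow_neg hb1.le]
    field_simp
  rw [e1, show -1 - s + 1 = -s by ring]
  calc _ = (1 + a) ^ (-s) * ((1 - ((1 + a) / (1 + b)) ^ s) / s) := by field_simp; ring
    _ ≤ (1 + a) ^ (-s) * ((1 + 1 / s) * (1 - (1 + a) / (1 + b))) := by gcongr
    _ = _ := by field_simp; ring

lemma integral_one_add_rpow_le_inv {c y : ℝ} (hc : 1 < c) (hy : 0 ≤ y) :
    ∫ x in (0:ℝ)..y, (1 + x) ^ (-c) ≤ 1 / (c - 1) := by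
  rw [integral_one_add_rpow (by linarith) le_rfl hy]
  have h1 : 0 ≤ (1 + y) ^ (-c + 1) := by positivity
  rw [show ((1 + y) ^ (-c + 1) - (1 + 0) ^ (-c + 1)) / (-c + 1)
    = (1 - (1 + y) ^ (-c + 1)) / (c - 1) by
      rw [← neg_div_neg_eq]; simp [sub_eq_neg_add]]
  have : 0 < c - 1 := by linarith
  gcongr
  linarith

/-- Integrating a radial weight over an incoming characteristic segment. -/
lemma integral_abs_two_mul_sub {f : ℝ → ℝ} (hf : Continuous f) {y : ℝ} (hy : 0 ≤ y) :
    ∫ σ in (0:ℝ)..y, f |2 * σ - y| = ∫ z in (0:ℝ)..y, f z := by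
  have hc : Continuous fun z => f |z| := hf.comp continuous_abs
  rw [intervalIntegral.integral_comp_mul_sub (fun z => f |z|) two_ne_zero]
  have h0 : ∫ z in (0:ℝ)..y, f |z| = ∫ z in (0:ℝ)..y, f z := by
    refine intervalIntegral.integral_congr fun z hz => ?_
    rw [uIcc_of_le hy] at hz
    simp only [abs_of_nonneg hz.1]
  have h1 : ∫ z in (-y)..0, f |z| = ∫ z in (0:ℝ)..y, f |z| := by
    have := intervalIntegral.integral_comp_neg (a := -y) (b := 0) (fun z => f |z|)
    simpa using this
  rw [show 2 * 0 - y = -y by ring, show 2 * y - y = y by ring,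
    ← intervalIntegral.integral_add_adjacent_intervals (b := 0) (hc.intervalIntegrable _ _)
      (hc.intervalIntegrable _ _), h1, h0, smul_eq_mul]
  ring

lemma continuous_one_add_abs_rpow {e : ℝ} {X : Type*} [TopologicalSpace X] {f : X → ℝ}
    (hf : Continuous f) : Continuous fun x => (1 + |f x|) ^ e :=
  (by fun_prop : Continuous fun x => 1 + |f x|).rpow_const fun x => Or.inl (by positivity)

lemma integral_incoming_eq {c y : ℝ} (hy : 0 ≤ y) :
    ∫ σ in (0:ℝ)..y, (1 + |2 * σ - y|) ^ (-c) = ∫ z in (0:ℝ)..y, (1 + z) ^ (-c) := by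
  have := integral_abs_two_mul_sub (f := fun z => (1 + |z|) ^ (-c))
    (continuous_one_add_abs_rpow continuous_id) hy
  simp only [abs_abs] at this
  rw [this]
  refine intervalIntegral.integral_congr fun z hz => ?_
  rw [uIcc_of_le hy] at hz
  simp only [abs_of_nonneg hz.1]

/-- Up to a constant, the incoming integral of `⟨u⟩^{-c}` is `⟨u⟩^{1-β}`. -/
lemma exists_integral_incoming_le {β c : ℝ} (h : (β < 1 ∧ β ≤ c) ∨ (β = 1 ∧ 1 < c)) :
    ∃ J : ℝ, 0 < J ∧ ∀ y : ℝ, 0 ≤ y →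
      ∫ σ in (0:ℝ)..y, (1 + |2 * σ - y|) ^ (-c) ≤ J * (1 + y) ^ (1 - β) := by
  rcases h with ⟨h1, h2⟩ | ⟨rfl, h2⟩
  · refine ⟨1 / (1 - β), by have : 0 < 1 - β := by linarith
                            positivity, fun y hy => ?_⟩
    rw [integral_incoming_eq hy]
    have hm : ∫ z in (0:ℝ)..y, (1 + z) ^ (-c) ≤ ∫ z in (0:ℝ)..y, (1 + z) ^ (-β) := by
      refine intervalIntegral.integral_mono_on hy ?_ ?_ fun z hz => ?_
      · refine ContinuousOn.intervalIntegrable fun z hz => ?_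
        rw [uIcc_of_le hy] at hz
        exact ((continuous_const.add continuous_id).continuousAt.rpow_const
          (Or.inl ((by linarith [hz.1] : (0:ℝ) < 1 + z).ne'))).continuousWithinAt
      · refine ContinuousOn.intervalIntegrable fun z hz => ?_
        rw [uIcc_of_le hy] at hz
        exact ((continuous_const.add continuous_id).continuousAt.rpow_const
          (Or.inl ((by linarith [hz.1] : (0:ℝ) < 1 + z).ne'))).continuousWithinAt
      · exact Real.rpow_le_rpow_of_exponent_le (by linarith [hz.1]) (by linarith)
    refine hm.trans ?_
    rw [integral_one_add_rpow (by linarith) le_rfl hy, show -β + 1 = 1 - β by ring]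
    have : 0 < 1 - β := by linarith
    rw [one_div_mul_eq_div]
    gcongr
    simp
  · refine ⟨1 / (c - 1), by have : 0 < c - 1 := by linarith
                            positivity, fun y hy => ?_⟩
    rw [integral_incoming_eq hy]
    simpa using integral_one_add_rpow_le_inv h2 hy

/-- The source term generated by `ψ`, frozen for negative times. -/
def src (q : ℝ) (ψ : ℝ → ℝ → ℝ) (t r : ℝ) : ℝ := nl q r (ψ (max t 0) r)

/-- Small null data `k = ∂_v ψ` at time zero of a radial function supported in the unit ball. -/
structure NullData (ε : ℝ) (k : ℝ → ℝ) : Prop where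
  cont : Continuous k
  bound : ∀ x, |k x| ≤ ε
  lip : ∀ x y, |k x - k y| ≤ ε * |x - y|
  supp : ∀ x, 1 ≤ |x| → k x = 0
  mean : ∫ x in (-1:ℝ)..1, k x = 0

/-- Odd continuous functions supported in the light cone over the unit ball, of size `O(r)`. -/
structure RadialClass (M : ℝ) (ψ : ℝ → ℝ → ℝ) : Prop where
  cont : Continuous fun p : ℝ × ℝ => ψ (max p.1 0) p.2
  odd : ∀ t r, 0 ≤ t → ψ t (-r) = -ψ t r
  supp : ∀ t r, 0 ≤ t → t + 1 ≤ r → ψ t r = 0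
  linear : ∀ t r, 0 ≤ t → 0 ≤ r → |ψ t r| ≤ M * r

/-- The weighted class for the second component. -/
structure WaveClass (s M : ℝ) (ψ : ℝ → ℝ → ℝ) : Prop extends RadialClass M ψ where
  bound : ∀ t r, 0 ≤ t → 0 ≤ r →
    |ψ t r| ≤ M * (r * (1 + (t + r))⁻¹ * (1 + |t - r|) ^ (-s))
  lip : ∀ t r d, 0 ≤ t → 0 ≤ r → 0 ≤ d →
    |ψ (t + d) (r + d) - ψ t r| ≤ M * (d * (1 + (t + r + 2 * d))⁻¹ * (1 + |t - r|) ^ (-s))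

/-- The weighted class for the time derivative of the first component. -/
structure VelClass (q β M : ℝ) (p : ℝ → ℝ → ℝ) : Prop extends RadialClass M p where
  bound : ∀ t r, 0 ≤ t → 0 ≤ r →
    |p t r| ≤ M * (r * (1 + (t + r)) ^ (1 - q) * (1 + |t - r|) ^ (-β))

namespace RadialClass

variable {M q : ℝ} {ψ : ℝ → ℝ → ℝ}

lemma linear_abs (h : RadialClass M ψ) {t : ℝ} (ht : 0 ≤ t) (r : ℝ) : |ψ t r| ≤ M * |r| := by
  rcases le_total 0 r with hr | hr
  · rw [abs_of_nonneg hr]; exact h.linear t r ht hr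
  · have := h.linear t (-r) ht (by linarith)
    rwa [h.odd t r ht, abs_neg, ← abs_of_nonpos hr] at this

lemma continuous_src (h : RadialClass M ψ) (hM : 0 ≤ M) (hq : 0 < q) :
    Continuous (uncurry (src q ψ)) :=
  continuous_nl hq hM (f := fun s ρ => ψ (max s 0) ρ) h.cont
    fun s ρ => h.linear_abs (le_max_right s 0) ρ

lemma src_odd (h : RadialClass M ψ) (t r : ℝ) : src q ψ t (-r) = -src q ψ t r := by
  rw [src, h.odd _ _ (le_max_right t 0), nl_neg_neg, src]

lemma src_supp (h : RadialClass M ψ) (hq : 0 < q) {t r : ℝ} (ht : 0 ≤ t) (hr : t + 1 ≤ r) :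
    src q ψ t r = 0 := by
  rw [src, max_eq_left ht, h.supp t r ht hr, nl_zero_right hq]

end RadialClass

namespace NullData

variable {ε : ℝ} {k : ℝ → ℝ}

lemma nonneg (h : NullData ε k) : 0 ≤ ε := (abs_nonneg _).trans (h.bound 0)

lemma integral_eq_zero (h : NullData ε k) {a b : ℝ} (ha : a ≤ -1) (hb : 1 ≤ b) :
    ∫ x in a..b, k x = 0 := by
  have hi : ∀ a b, IntervalIntegrable k volume a b := fun a b => h.cont.intervalIntegrable a b
  rw [← intervalIntegral.integral_add_adjacent_intervals (hi a (-1)) (hi (-1) b),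
    ← intervalIntegral.integral_add_adjacent_intervals (hi (-1) 1) (hi 1 b), h.mean]
  have h1 : ∫ x in a..(-1), k x = ∫ x in a..(-1), (0:ℝ) :=
    intervalIntegral.integral_congr fun x hx => by
      rw [uIcc_of_le ha] at hx
      exact h.supp x (by rw [abs_of_nonpos (by linarith [hx.2])]; linarith [hx.2])
  have h2 : ∫ x in (1:ℝ)..b, k x = ∫ x in (1:ℝ)..b, (0:ℝ) :=
    intervalIntegral.integral_congr fun x hx => by
      rw [uIcc_of_le hb] at hx
      exact h.supp x (hx.1.trans (le_abs_self x))
  simp [h1, h2]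

end NullData

lemma wave_supp {k : ℝ → ℝ} {G : ℝ → ℝ → ℝ} {ε : ℝ} (hk : NullData ε k)
    (hG : Continuous (uncurry G)) (hodd : ∀ s ρ, G s (-ρ) = -G s ρ)
    (hsupp : ∀ s ρ, 0 ≤ s → s + 1 ≤ ρ → G s ρ = 0) {t r : ℝ} (ht : 0 ≤ t) (hr : t + 1 ≤ r) :
    wave k G t r = 0 := by
  rw [wave_eq_domain hG hodd, hk.integral_eq_zero (by linarith) (by linarith)]
  have : ∫ s in (0:ℝ)..t, ∫ ρ in |t - r - s|..(t + r - s), G s ρ = ∫ s in (0:ℝ)..t, (0:ℝ) := by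
    refine intervalIntegral.integral_congr fun s hs => ?_
    rw [uIcc_of_le ht] at hs
    have e : |t - r - s| = r - t + s := by rw [abs_of_nonpos (by linarith [hs.1])]; ring
    have : ∫ ρ in |t - r - s|..(t + r - s), G s ρ = ∫ ρ in |t - r - s|..(t + r - s), (0:ℝ) := by
      refine intervalIntegral.integral_congr fun ρ hρ => ?_
      rw [e, uIcc_of_le (by linarith [hs.2])] at hρ
      exact hsupp s ρ hs.1 (by linarith [hρ.1])
    simpa using this
  simp [this]

lemma vel_supp {k : ℝ → ℝ} {G : ℝ → ℝ → ℝ} {ε : ℝ} (hk : NullData ε k)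
    (hodd : ∀ s ρ, G s (-ρ) = -G s ρ)
    (hsupp : ∀ s ρ, 0 ≤ s → s + 1 ≤ ρ → G s ρ = 0) {t r : ℝ} (ht : 0 ≤ t) (hr : t + 1 ≤ r) :
    vel k G t r = 0 := by
  have h0 : ∀ x, (∀ s, 0 ≤ s → s ≤ t → G s (x - s) = 0) → ∫ s in (0:ℝ)..t, G s (x - s) = 0 := by
    intro x hx
    have : ∫ s in (0:ℝ)..t, G s (x - s) = ∫ s in (0:ℝ)..t, (0:ℝ) :=
      intervalIntegral.integral_congr fun s hs => by
        rw [uIcc_of_le ht] at hs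
        exact hx s hs.1 hs.2
    simpa using this
  rw [vel, ray, ray, hk.supp (t + r) (by rw [abs_of_nonneg (by linarith)]; linarith),
    hk.supp (t - r) (by rw [abs_of_nonpos (by linarith)]; linarith),
    h0 _ fun s hs hst => hsupp s _ hs (by linarith), h0 _ fun s hs hst => ?_]
  · simp
  · rw [show t - r - s = -(s + r - t) by ring, hodd, hsupp s _ hs (by linarith), neg_zero]

/-- Weights along incoming rays: the nonlinear source of a `VelClass` function. -/
lemma VelClass.abs_src_le {q β M q₂ : ℝ} {p : ℝ → ℝ → ℝ} (hp : VelClass q β M p) (hM : 0 ≤ M)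
    (hq₂ : 0 < q₂) {t r : ℝ} (ht : 0 ≤ t) (hr : 0 ≤ r) :
    |src q₂ p t r| ≤ M ^ q₂ * ((1 + (t + r)) ^ (1 + (1 - q) * q₂) * (1 + |t - r|) ^ (-(β * q₂))) := by
  have hx : 0 < 1 + (t + r) := by linarith
  have hy : 0 < 1 + |t - r| := by positivity
  rw [src, max_eq_left ht]
  have h := abs_nl_le (q := q₂) (ρ := r) (z := p t r)
    (m := M * ((1 + (t + r)) ^ (1 - q) * (1 + |t - r|) ^ (-β))) hq₂.le (by positivity)
    (by rw [abs_of_nonneg hr]; exact (hp.bound t r ht hr).trans_eq (by ring))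
  refine h.trans ?_
  rw [abs_of_nonneg hr, Real.mul_rpow hM (by positivity), Real.mul_rpow (by positivity)
    (by positivity), ← Real.rpow_mul hx.le, ← Real.rpow_mul hy.le, Real.rpow_add hx, Real.rpow_one,
    neg_mul]
  have : r ≤ 1 + (t + r) := by linarith
  calc _ = M ^ q₂ * (r * (1 + (t + r)) ^ ((1 - q) * q₂) * (1 + |t - r|) ^ (-(β * q₂))) := by ring
    _ ≤ _ := by gcongr

/-- Weights along incoming rays: the nonlinear source of a `WaveClass` function. -/
lemma WaveClass.abs_src_le {q s M : ℝ} {ψ : ℝ → ℝ → ℝ} (hψ : WaveClass s M ψ) (hM : 0 ≤ M)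
    (hq : 0 < q) {t r : ℝ} (ht : 0 ≤ t) (hr : 0 ≤ r) :
    |src q ψ t r| ≤ M ^ q * ((1 + (t + r)) ^ (1 - q) * (1 + |t - r|) ^ (-(q * s))) := by
  have hx : 0 < 1 + (t + r) := by linarith
  have hy : 0 < 1 + |t - r| := by positivity
  rw [src, max_eq_left ht]
  have h := abs_nl_le (q := q) (ρ := r) (z := ψ t r)
    (m := M * ((1 + (t + r)) ^ (-1 : ℝ) * (1 + |t - r|) ^ (-s))) hq.le (by positivity)
    (by rw [abs_of_nonneg hr, Real.rpow_neg_one]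
        exact (hψ.bound t r ht hr).trans_eq (by ring))
  refine h.trans ?_
  rw [abs_of_nonneg hr, Real.mul_rpow hM (by positivity), Real.mul_rpow (by positivity)
    (by positivity), ← Real.rpow_mul hx.le, ← Real.rpow_mul hy.le, sub_eq_add_neg 1 q,
    Real.rpow_add hx, Real.rpow_one, show -s * q = -(q * s) by ring, show -1 * q = -q by ring]
  have : r ≤ 1 + (t + r) := by linarith
  calc _ = M ^ q * (r * (1 + (t + r)) ^ (-q) * (1 + |t - r|) ^ (-(q * s))) := by ring
    _ ≤ _ := by gcongr

/-- The null derivative generated by a `VelClass` function. -/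
lemma exists_ray_src_bound {q q₂ s β : ℝ} (hq₂ : 0 < q₂) (he : 1 + (1 - q) * q₂ = -1 - s)
    (hs : 0 < s) (hβ : 1 < β * q₂) :
    ∃ C > 0, ∀ (M ε : ℝ) (k : ℝ → ℝ) (p : ℝ → ℝ → ℝ), 0 ≤ M → NullData ε k → VelClass q β M p →
      ∀ x t, 0 ≤ t → t ≤ x →
        |ray k (src q₂ p) x t| ≤ C * (ε + M ^ q₂) * (1 + x) ^ (-1 - s) := by
  have hc : 0 < β * q₂ - 1 := by linarith
  refine ⟨2 ^ (1 + s) + 1 / (β * q₂ - 1), by positivity, fun M ε k p hM hk hp x t ht htx => ?_⟩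
  have hx : 0 ≤ x := ht.trans htx
  have hε := hk.nonneg
  have hMq : 0 ≤ M ^ q₂ := by positivity
  have hw : 0 ≤ (1 + x) ^ (-1 - s) := by positivity
  have hk' : |k x| ≤ 2 ^ (1 + s) * ε * (1 + x) ^ (-1 - s) := by
    rcases le_or_gt 1 x with h1 | h1
    · rw [hk.supp x (h1.trans (le_abs_self x)), abs_zero]; positivity
    · have h2 : (1:ℝ) ≤ 2 ^ (1 + s) * (1 + x) ^ (-1 - s) := by
        have : (2:ℝ) ^ (-1 - s) ≤ (1 + x) ^ (-1 - s) :=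
          Real.rpow_le_rpow_of_nonpos (by linarith) (by linarith) (by linarith)
        calc (1:ℝ) = 2 ^ (1 + s) * 2 ^ (-1 - s) := by
              rw [← Real.rpow_add two_pos]; norm_num
          _ ≤ _ := by gcongr
      calc |k x| ≤ ε * 1 := by simpa using hk.bound x
        _ ≤ ε * (2 ^ (1 + s) * (1 + x) ^ (-1 - s)) := by gcongr
        _ = _ := by ring
  have hI : |∫ σ in (0:ℝ)..t, src q₂ p σ (x - σ)|
      ≤ 1 / (β * q₂ - 1) * M ^ q₂ * (1 + x) ^ (-1 - s) := by
    have hcont := continuous_one_add_abs_rpow (e := -(β * q₂))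
      (by fun_prop : Continuous fun σ : ℝ => 2 * σ - x)
    calc |∫ σ in (0:ℝ)..t, src q₂ p σ (x - σ)|
        ≤ ∫ σ in (0:ℝ)..t, M ^ q₂ * (1 + x) ^ (-1 - s) * (1 + |2 * σ - x|) ^ (-(β * q₂)) := by
          rw [← Real.norm_eq_abs]
          refine intervalIntegral.norm_integral_le_of_norm_le ht (ae_of_all _ fun σ hσ => ?_)
            ((hcont.const_mul _).intervalIntegrable _ _)
          have := hp.abs_src_le hM hq₂ hσ.1.le (r := x - σ) (by linarith [hσ.2])
          rw [he, show σ + (x - σ) = x by ring, show σ - (x - σ) = 2 * σ - x by ring] at this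
          exact this.trans_eq (by ring)
      _ = M ^ q₂ * (1 + x) ^ (-1 - s) * ∫ σ in (0:ℝ)..t, (1 + |2 * σ - x|) ^ (-(β * q₂)) :=
          intervalIntegral.integral_const_mul _ _
      _ ≤ M ^ q₂ * (1 + x) ^ (-1 - s) * (1 / (β * q₂ - 1)) := by
          gcongr
          refine le_trans ?_ (integral_one_add_rpow_le_inv hβ hx)
          rw [← integral_incoming_eq hx]
          exact intervalIntegral.integral_mono_interval le_rfl ht htx
            (ae_of_all _ fun σ => by simp only [Pi.zero_apply]; positivity) (hcont.intervalIntegrable _ _)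
      _ = _ := by ring
  calc |ray k (src q₂ p) x t| ≤ |k x| + |∫ σ in (0:ℝ)..t, src q₂ p σ (x - σ)| := abs_add_le _ _
    _ ≤ 2 ^ (1 + s) * ε * (1 + x) ^ (-1 - s)
        + 1 / (β * q₂ - 1) * M ^ q₂ * (1 + x) ^ (-1 - s) := add_le_add hk' hI
    _ ≤ 2 ^ (1 + s) * (ε + M ^ q₂) * (1 + x) ^ (-1 - s)
        + 1 / (β * q₂ - 1) * (ε + M ^ q₂) * (1 + x) ^ (-1 - s) := by
          gcongr <;> linarith
    _ = _ := by ring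

/-- A bound on the null derivative puts the wave evolution into `WaveClass`. -/
lemma waveClass_of_ray_bound {s ε A : ℝ} {k : ℝ → ℝ} {G : ℝ → ℝ → ℝ} (hs : 0 < s)
    (hk : NullData ε k) (hεA : ε ≤ A) (hG : Continuous (uncurry G))
    (hodd : ∀ s ρ, G s (-ρ) = -G s ρ) (hsupp : ∀ s ρ, 0 ≤ s → s + 1 ≤ ρ → G s ρ = 0)
    (hray : ∀ x t, 0 ≤ t → t ≤ x → |ray k G x t| ≤ A * (1 + x) ^ (-1 - s)) :
    WaveClass s ((1 + 1 / s + 3 * 2 ^ s) * A) (wave k G) := by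
  have hε := hk.nonneg
  have hA : 0 ≤ A := hε.trans hεA
  have hlip : ∀ t r d, 0 ≤ t → 0 ≤ r → 0 ≤ d →
      |wave k G (t + d) (r + d) - wave k G t r|
        ≤ (1 + 1 / s) * A * (d * (1 + (t + r + 2 * d))⁻¹ * (1 + |t - r|) ^ (-s)) := by
    intro t r d ht hr hd
    have habs : |t - r| ≤ t + r := abs_le.2 ⟨by linarith, by linarith⟩
    rw [wave_sub_wave hk.cont hG hodd]
    have hcont : Continuous fun τ : ℝ => (1 + |t + r + 2 * τ|) ^ (-1 - s) :=
      continuous_one_add_abs_rpow (by fun_prop : Continuous fun τ : ℝ => t + r + 2 * τ)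
    calc |∫ τ in (0:ℝ)..d, ray k G (t + r + 2 * τ) (t + τ)|
        ≤ ∫ τ in (0:ℝ)..d, A * (1 + |t + r + 2 * τ|) ^ (-1 - s) := by
          rw [← Real.norm_eq_abs]
          refine intervalIntegral.norm_integral_le_of_norm_le hd (ae_of_all _ fun τ hτ => ?_)
            ((hcont.const_mul _).intervalIntegrable _ _)
          rw [abs_of_nonneg (by linarith [hτ.1])]
          exact hray _ _ (by linarith [hτ.1]) (by linarith [hτ.1])
      _ = A * ∫ τ in (0:ℝ)..d, (1 + |t + r + 2 * τ|) ^ (-1 - s) :=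
          intervalIntegral.integral_const_mul _ _
      _ = A * (2⁻¹ * ∫ x in (t + r)..(t + r + 2 * d), (1 + x) ^ (-1 - s)) := by
          have h := intervalIntegral.integral_comp_add_mul (a := 0) (b := d)
            (fun x : ℝ => (1 + |x|) ^ (-1 - s)) (two_ne_zero' ℝ) (t + r)
          rw [h, smul_eq_mul]
          congr 2
          simp only [mul_zero, add_zero]
          refine intervalIntegral.integral_congr fun x hx => ?_
          rw [uIcc_of_le (by linarith)] at hx
          simp only [abs_of_nonneg (by linarith [hx.1] : 0 ≤ x)]
      _ ≤ A * (2⁻¹ * ((1 + 1 / s) * ((t + r + 2 * d - (t + r)) * (1 + (t + r + 2 * d))⁻¹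
            * (1 + (t + r)) ^ (-s)))) := by
          gcongr
          exact integral_one_add_rpow_neg_le hs (by linarith) (by linarith)
      _ ≤ A * (2⁻¹ * ((1 + 1 / s) * ((t + r + 2 * d - (t + r)) * (1 + (t + r + 2 * d))⁻¹
            * (1 + |t - r|) ^ (-s)))) := by
          have : (1 + (t + r)) ^ (-s) ≤ (1 + |t - r|) ^ (-s) :=
            Real.rpow_le_rpow_of_nonpos (by positivity) (by linarith) (by linarith)
          have h0 : 0 ≤ t + r + 2 * d - (t + r) := by linarith
          gcongr
      _ = _ := by ring
  have hbound : ∀ t r, 0 ≤ t → 0 ≤ r → |wave k G t r|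
      ≤ (1 + 1 / s + 3 * 2 ^ s) * A * (r * (1 + (t + r))⁻¹ * (1 + |t - r|) ^ (-s)) := by
    intro t r ht hr
    have hw : 0 ≤ (1 + (t + r))⁻¹ * (1 + |t - r|) ^ (-s) := by positivity
    rcases le_total r t with hrt | htr
    · have h := hlip (t - r) 0 r (by linarith) le_rfl hr
      have h0 : wave k G (t - r) 0 = 0 := by simp [wave]
      simp only [sub_add_cancel, zero_add, h0, sub_zero, add_zero] at h
      rw [show t - r + 2 * r = t + r by ring] at h
      refine h.trans ?_
      have : (0:ℝ) ≤ 3 * 2 ^ s := by positivity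
      gcongr ?_ * _ * _
      linarith
    rcases le_or_gt (t + 1) r with h1 | h1
    · rw [wave_supp hk hG hodd hsupp ht h1, abs_zero]; positivity
    have h := hlip 0 (r - t) t le_rfl (by linarith) ht
    simp only [zero_add, sub_add_cancel] at h
    rw [show r - t + 2 * t = t + r by ring, zero_sub, neg_sub] at h
    have hdata : |wave k G 0 (r - t)| ≤ ε * (r - t) := by
      have : ‖∫ x in (0 - (r - t))..(0 + (r - t)), k x‖ ≤ ε * |0 + (r - t) - (0 - (r - t))| :=
        intervalIntegral.norm_integral_le_of_norm_le_const fun x _ => hk.bound x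
      rw [abs_of_nonneg (by linarith : 0 ≤ 0 + (r - t) - (0 - (r - t))), Real.norm_eq_abs] at this
      simp only [wave, intervalIntegral.integral_same, zero_div, add_zero]
      rw [abs_div, abs_two]
      linarith
    have habs : |t - r| = r - t := by rw [abs_sub_comm, abs_of_nonneg (by linarith)]
    have h2 : ε * (r - t) ≤ 3 * 2 ^ s * A * (r * (1 + (t + r))⁻¹ * (1 + |t - r|) ^ (-s)) := by
      have h3 : (r - t) ≤ 3 * r * (1 + (t + r))⁻¹ := by
        rw [← div_eq_mul_inv, le_div_iff₀ (by linarith)]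
        nlinarith
      have h4 : (1:ℝ) ≤ 2 ^ s * (1 + |t - r|) ^ (-s) := by
        have : (2:ℝ) ^ (-s) ≤ (1 + |t - r|) ^ (-s) :=
          Real.rpow_le_rpow_of_nonpos (by positivity) (by linarith) (by linarith)
        calc (1:ℝ) = 2 ^ s * 2 ^ (-s) := by rw [← Real.rpow_add two_pos]; norm_num
          _ ≤ _ := by gcongr
      calc ε * (r - t) ≤ A * (3 * r * (1 + (t + r))⁻¹ * 1) := by
            rw [mul_one]; gcongr
        _ ≤ A * (3 * r * (1 + (t + r))⁻¹ * (2 ^ s * (1 + |t - r|) ^ (-s))) := by gcongr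
        _ = _ := by ring
    have h5 : |wave k G t r| ≤ |wave k G t r - wave k G 0 (r - t)| + |wave k G 0 (r - t)| := by
      simpa using abs_add_le (wave k G t r - wave k G 0 (r - t)) (wave k G 0 (r - t))
    have h6 : (1 + 1 / s) * A * (t * (1 + (t + r))⁻¹ * (1 + |t - r|) ^ (-s))
        ≤ (1 + 1 / s) * A * (r * (1 + (t + r))⁻¹ * (1 + |t - r|) ^ (-s)) := by gcongr
    have h7 : (1 + 1 / s + 3 * 2 ^ s) * A * (r * (1 + (t + r))⁻¹ * (1 + |t - r|) ^ (-s))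
        = (1 + 1 / s) * A * (r * (1 + (t + r))⁻¹ * (1 + |t - r|) ^ (-s))
          + 3 * 2 ^ s * A * (r * (1 + (t + r))⁻¹ * (1 + |t - r|) ^ (-s)) := by ring
    linarith
  have hC : 0 ≤ (1 + 1 / s + 3 * 2 ^ s) * A := by positivity
  refine ⟨⟨?_, fun t r _ => wave_neg k G t r, fun t r ht hr => wave_supp hk hG hodd hsupp ht hr,
    fun t r ht hr => (hbound t r ht hr).trans ?_⟩, hbound, fun t r d ht hr hd =>
    (hlip t r d ht hr hd).trans ?_⟩
  · exact (continuous_wave hk.cont hG).comp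
      (by fun_prop : Continuous fun p : ℝ × ℝ => (max p.1 0, p.2))
  · gcongr
    have h1 : (1 + (t + r))⁻¹ ≤ 1 := inv_le_one_of_one_le₀ (by linarith)
    have h2 : (1 + |t - r|) ^ (-s) ≤ 1 :=
      Real.rpow_le_one_of_one_le_of_nonpos (by linarith [abs_nonneg (t - r)]) (by linarith)
    have h3 : 0 ≤ (1 + (t + r))⁻¹ := by positivity
    calc r * (1 + (t + r))⁻¹ * (1 + |t - r|) ^ (-s) ≤ r * 1 * 1 := by gcongr
      _ = r := by ring
  · have : (0:ℝ) ≤ 3 * 2 ^ s := by positivity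
    gcongr ?_ * _ * _
    linarith

lemma NullData.abs_sub_le {ε q β : ℝ} {k : ℝ → ℝ} (hk : NullData ε k) (hq : q ≤ 2) (hβ : β ≤ 1)
    {t r : ℝ} (ht : 0 ≤ t) (hr : 0 ≤ r) :
    |k (t + r) - k (t - r)| ≤ 16 * ε * (r * (1 + (t + r)) ^ (1 - q) * (1 + |t - r|) ^ (-β)) := by
  have hε := hk.nonneg
  have habs : |t - r| ≤ t + r := abs_le.2 ⟨by linarith, by linarith⟩
  rcases le_or_gt 1 |t - r| with h1 | h1
  · rw [hk.supp _ h1, hk.supp (t + r) ((h1.trans habs).trans (le_abs_self _)), sub_zero, abs_zero]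
    positivity
  have h2 : |k (t + r) - k (t - r)| ≤ 2 * ε * r :=
    (hk.lip _ _).trans_eq (by
      rw [show t + r - (t - r) = 2 * r by ring, abs_of_nonneg (by linarith)]; ring)
  have h3 : |k (t + r) - k (t - r)| ≤ 2 * ε := by
    have := abs_sub (k (t + r)) (k (t - r))
    linarith [hk.bound (t + r), hk.bound (t - r)]
  have hx : t + r ≤ 1 + 2 * r := by linarith [(abs_lt.1 h1).2]
  have h4 : |k (t + r) - k (t - r)| ≤ 8 * ε * r * (1 + (t + r))⁻¹ := by
    rw [← div_eq_mul_inv, le_div_iff₀ (by linarith)]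
    rcases le_total r 1 with h | h
    · calc _ ≤ 2 * ε * r * 4 := by gcongr; linarith
        _ = _ := by ring
    · calc _ ≤ 2 * ε * (4 * r) := by gcongr; linarith
        _ = _ := by ring
  have h5 : (1 + (t + r))⁻¹ ≤ (1 + (t + r)) ^ (1 - q) := by
    rw [← Real.rpow_neg_one]
    exact Real.rpow_le_rpow_of_exponent_le (by linarith) (by linarith)
  have h6 : (2:ℝ)⁻¹ ≤ (1 + |t - r|) ^ (-β) := by
    calc (2:ℝ)⁻¹ ≤ (1 + |t - r|)⁻¹ := by gcongr; linarith
      _ = (1 + |t - r|) ^ (-1 : ℝ) := (Real.rpow_neg_one _).symm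
      _ ≤ _ := Real.rpow_le_rpow_of_exponent_le (by linarith [abs_nonneg (t - r)]) (by linarith)
  calc _ ≤ 16 * ε * (r * (1 + (t + r))⁻¹ * 2⁻¹) := h4.trans_eq (by ring)
    _ ≤ _ := by gcongr

namespace WaveClass

variable {q s M : ℝ} {ψ : ℝ → ℝ → ℝ}

lemma abs_integral_incoming_le (h : WaveClass s M ψ) (hM : 0 ≤ M) (hq : 0 < q) (hs : 0 ≤ s)
    {d x : ℝ} (hd : 0 ≤ d) (hdx : d ≤ x) :
    |∫ σ in (0:ℝ)..d, src q ψ σ (x - σ)| ≤ M ^ q * (d * (1 + x) ^ (1 - q)) := by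
  have := intervalIntegral.norm_integral_le_of_norm_le_const (a := 0) (b := d)
    (f := fun σ => src q ψ σ (x - σ)) (C := M ^ q * (1 + x) ^ (1 - q)) fun σ hσ => ?_
  · rw [sub_zero, abs_of_nonneg hd, Real.norm_eq_abs] at this
    exact this.trans_eq (by ring)
  · rw [uIoc_of_le hd] at hσ
    have h1 := h.abs_src_le hM hq hσ.1.le (r := x - σ) (by linarith [hσ.2])
    rw [show σ + (x - σ) = x by ring] at h1
    refine h1.trans ?_
    have : (1 + |σ - (x - σ)|) ^ (-(q * s)) ≤ 1 :=
      Real.rpow_le_one_of_one_le_of_nonpos (by linarith [abs_nonneg (σ - (x - σ))])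
        (by have := mul_nonneg hq.le hs; linarith)
    have hx : 0 ≤ (1 + x) ^ (1 - q) := Real.rpow_nonneg (by linarith) _
    calc _ ≤ M ^ q * ((1 + x) ^ (1 - q) * 1) := by gcongr
      _ = _ := by ring

lemma abs_integral_outgoing_le (h : WaveClass s M ψ) (hM : 0 ≤ M) (hq : 1 < q) (hq' : q < 2)
    {a t y : ℝ} (ha : 0 ≤ a) (hat : a ≤ t) (hay : |y| = 2 * a - y) (hya : y ≤ a) :
    |∫ σ in a..t, src q ψ σ (y - σ)|
      ≤ M ^ q / (2 - q) * ((t - a) * (1 + (2 * t - y)) ^ (1 - q) * (1 + |y|) ^ (-(q * s))) := by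
  have hq2 : 0 < 2 - q := by linarith
  have hcont : Continuous fun σ : ℝ => (1 + |2 * σ - y|) ^ (1 - q) :=
    continuous_one_add_abs_rpow (by fun_prop)
  rw [← Real.norm_eq_abs]
  calc ‖∫ σ in a..t, src q ψ σ (y - σ)‖
      ≤ ∫ σ in a..t, M ^ q * (1 + |y|) ^ (-(q * s)) * (1 + |2 * σ - y|) ^ (1 - q) := by
        refine intervalIntegral.norm_integral_le_of_norm_le hat (ae_of_all _ fun σ hσ => ?_)
          ((hcont.const_mul _).intervalIntegrable _ _)
        rw [← neg_sub σ y, h.src_odd, norm_neg, Real.norm_eq_abs]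
        have h1 := h.abs_src_le hM (by linarith : 0 < q) (ha.trans hσ.1.le) (r := σ - y)
          (by linarith [hσ.1])
        rw [show σ + (σ - y) = 2 * σ - y by ring, sub_sub_cancel] at h1
        rw [abs_of_nonneg (by linarith [hσ.1, abs_nonneg y] : 0 ≤ 2 * σ - y)]
        exact h1.trans_eq (by ring)
    _ = M ^ q * (1 + |y|) ^ (-(q * s)) * ∫ σ in a..t, (1 + |2 * σ - y|) ^ (1 - q) :=
        intervalIntegral.integral_const_mul _ _
    _ = M ^ q * (1 + |y|) ^ (-(q * s)) * (2⁻¹ * ∫ x in |y|..(2 * t - y), (1 + x) ^ (1 - q)) := by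
        rw [intervalIntegral.integral_comp_mul_sub (fun x : ℝ => (1 + |x|) ^ (1 - q))
          (two_ne_zero' ℝ) y, smul_eq_mul, ← hay]
        congr 2
        refine intervalIntegral.integral_congr fun x hx => ?_
        rw [uIcc_of_le (by linarith)] at hx
        simp only [abs_of_nonneg ((abs_nonneg y).trans hx.1)]
    _ ≤ M ^ q * (1 + |y|) ^ (-(q * s))
        * (2⁻¹ * ((2 * t - y - |y|) * (1 + (2 * t - y)) ^ (1 - q) / (1 - q + 1))) := by
        gcongr
        exact integral_one_add_rpow_le (by linarith) (by linarith) (abs_nonneg y) (by linarith)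
    _ = _ := by
        rw [hay, show 1 - q + 1 = 2 - q by ring]
        field_simp
        ring

lemma abs_src_shift_sub_le (h : WaveClass s M ψ) (hM : 0 ≤ M) (hq : 1 < q) (hq' : q < 2)
    {σ ρ r : ℝ} (hσ : 0 ≤ σ) (hρ : 0 ≤ ρ) (hr : 0 ≤ r) :
    |src q ψ (σ + r) (ρ + r) - src q ψ σ ρ|
      ≤ 4 * q * M ^ q * (r * (1 + (σ + ρ + 2 * r)) ^ (1 - q) * (1 + (σ + ρ))⁻¹
        * (1 + |σ - ρ|) ^ (-(q * s))) := by
  set y := σ + ρ with hy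
  set x := y + 2 * r with hx
  set z := |σ - ρ| with hz
  have hy0 : 0 < 1 + y := by positivity
  have hx0 : 0 < 1 + x := by positivity
  have hz0 : 0 < 1 + z := by positivity
  have hyx : y ≤ x := by linarith
  have e1 : σ + r + (ρ + r) = x := by rw [hx, hy]; ring
  have e2 : |σ + r - (ρ + r)| = z := by rw [hz]; congr 1; ring
  have b1 := h.bound σ ρ hσ hρ
  have b2 := h.bound (σ + r) (ρ + r) (by linarith) (by linarith)
  have b3 := h.lip σ ρ r hσ hρ hr
  rw [e1, e2] at b2
  have key := abs_nl_radius_sub_le (q := q) (r₁ := ρ) (r₂ := ρ + r) (z₁ := ψ σ ρ)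
    (z₂ := ψ (σ + r) (ρ + r)) (m := M * ((1 + y)⁻¹ * (1 + z) ^ (-s)))
    (m₂ := M * ((1 + x)⁻¹ * (1 + z) ^ (-s))) hq.le hρ (by linarith) (by positivity) (by gcongr)
    (b1.trans_eq (by ring)) (b2.trans_eq (by ring))
  rw [src, src, max_eq_left (by linarith), max_eq_left hσ]
  refine key.trans ?_
  have hw : (1 + y) ^ (1 - q) * (1 + x)⁻¹ ≤ (1 + x) ^ (1 - q) * (1 + y)⁻¹ := by
    rw [← div_eq_mul_inv, ← div_eq_mul_inv, div_le_div_iff₀ hx0 hy0,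
      ← Real.rpow_add_one hy0.ne', ← Real.rpow_add_one hx0.ne']
    exact Real.rpow_le_rpow hy0.le (by linarith) (by linarith)
  have hm : (M * ((1 + y)⁻¹ * (1 + z) ^ (-s))) ^ (q - 1) * (M * ((1 + x)⁻¹ * (1 + z) ^ (-s)))
      = M ^ q * ((1 + y) ^ (1 - q) * (1 + x)⁻¹) * (1 + z) ^ (-(q * s)) := by
    rw [Real.mul_rpow hM (by positivity), Real.mul_rpow (by positivity) (by positivity),
      Real.inv_rpow hy0.le, ← Real.rpow_neg hy0.le, neg_sub, ← Real.rpow_mul hz0.le]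
    have e3 : M ^ q = M ^ (q - 1) * M := by
      rw [← Real.rpow_add_one' hM (by linarith), sub_add_cancel]
    have e4 : (1 + z) ^ (-(q * s)) = (1 + z) ^ (-s * (q - 1)) * (1 + z) ^ (-s) := by
      rw [← Real.rpow_add hz0]; congr 1; ring
    rw [e3, e4]; ring
  calc 2 * q * (M * ((1 + y)⁻¹ * (1 + z) ^ (-s))) ^ (q - 1)
        * ((ρ + r - ρ) * (M * ((1 + x)⁻¹ * (1 + z) ^ (-s))) + |ψ (σ + r) (ρ + r) - ψ σ ρ|)
      ≤ 2 * q * (M * ((1 + y)⁻¹ * (1 + z) ^ (-s))) ^ (q - 1)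
        * ((ρ + r - ρ) * (M * ((1 + x)⁻¹ * (1 + z) ^ (-s)))
          + M * (r * (1 + x)⁻¹ * (1 + z) ^ (-s))) := by gcongr
    _ = 4 * q * r * ((M * ((1 + y)⁻¹ * (1 + z) ^ (-s))) ^ (q - 1)
        * (M * ((1 + x)⁻¹ * (1 + z) ^ (-s)))) := by ring
    _ = 4 * q * r * (M ^ q * ((1 + y) ^ (1 - q) * (1 + x)⁻¹) * (1 + z) ^ (-(q * s))) := by rw [hm]
    _ ≤ 4 * q * r * (M ^ q * ((1 + x) ^ (1 - q) * (1 + y)⁻¹) * (1 + z) ^ (-(q * s))) := by gcongr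
    _ = _ := by ring

lemma abs_integral_shift_le (h : WaveClass s M ψ) (hM : 0 ≤ M) (hq : 1 < q) (hq' : q < 2)
    {J β y r : ℝ} (hJ : ∀ y, 0 ≤ y →
      ∫ σ in (0:ℝ)..y, (1 + |2 * σ - y|) ^ (-(q * s)) ≤ J * (1 + y) ^ (1 - β))
    (hy : 0 ≤ y) (hr : 0 ≤ r) :
    |∫ σ in (0:ℝ)..y, (src q ψ (σ + r) (y - σ + r) - src q ψ σ (y - σ))|
      ≤ 4 * q * J * M ^ q * (r * (1 + (y + 2 * r)) ^ (1 - q) * (1 + y) ^ (-β)) := by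
  have hcont : Continuous fun σ : ℝ => (1 + |2 * σ - y|) ^ (-(q * s)) :=
    continuous_one_add_abs_rpow (by fun_prop)
  have hy0 : 0 < 1 + y := by linarith
  rw [← Real.norm_eq_abs]
  calc ‖∫ σ in (0:ℝ)..y, (src q ψ (σ + r) (y - σ + r) - src q ψ σ (y - σ))‖
      ≤ ∫ σ in (0:ℝ)..y, 4 * q * M ^ q * (r * (1 + (y + 2 * r)) ^ (1 - q) * (1 + y)⁻¹)
          * (1 + |2 * σ - y|) ^ (-(q * s)) := by
        refine intervalIntegral.norm_integral_le_of_norm_le hy (ae_of_all _ fun σ hσ => ?_)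
          ((hcont.const_mul _).intervalIntegrable _ _)
        have := h.abs_src_shift_sub_le hM hq hq' hσ.1.le (ρ := y - σ) (by linarith [hσ.2]) hr
        rw [show σ + (y - σ) = y by ring, show σ - (y - σ) = 2 * σ - y by ring] at this
        exact this.trans_eq (by ring)
    _ = 4 * q * M ^ q * (r * (1 + (y + 2 * r)) ^ (1 - q) * (1 + y)⁻¹)
          * ∫ σ in (0:ℝ)..y, (1 + |2 * σ - y|) ^ (-(q * s)) :=
        intervalIntegral.integral_const_mul _ _
    _ ≤ 4 * q * M ^ q * (r * (1 + (y + 2 * r)) ^ (1 - q) * (1 + y)⁻¹) * (J * (1 + y) ^ (1 - β)) := by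
        have : 0 ≤ q := by linarith
        gcongr
        exact hJ y hy
    _ = _ := by
        rw [sub_eq_add_neg 1 β, Real.rpow_add hy0, Real.rpow_one]
        field_simp

end WaveClass

/-- The velocity generated by a `WaveClass` function. -/
lemma exists_vel_src_class {q s β : ℝ} (hq : 1 < q) (hq' : q < 2) (hs : 0 < s) (hβ0 : 0 < β)
    (hβ : (β < 1 ∧ β ≤ q * s) ∨ (β = 1 ∧ 1 < q * s)) :
    ∃ C > 0, ∀ (M ε : ℝ) (k : ℝ → ℝ) (ψ : ℝ → ℝ → ℝ), 0 ≤ M → NullData ε k → WaveClass s M ψ →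
      VelClass q β (C * (ε + M ^ q)) (vel k (src q ψ)) := by
  obtain ⟨J, hJ, hJb⟩ := exists_integral_incoming_le hβ
  have hβ1 : β ≤ 1 := by rcases hβ with h | h <;> linarith
  have hβs : β ≤ q * s := by rcases hβ with h | h <;> linarith
  have hq2 : 0 < 2 - q := by linarith
  refine ⟨16 + 2 + 4 * q * J + 1 / (2 - q), by positivity, fun M ε k ψ hM hk hψ => ?_⟩
  have hq0 : 0 < q := by linarith
  have hε := hk.nonneg
  have hMq : 0 ≤ M ^ q := by positivity
  have hG := hψ.continuous_src hM hq0
  have hodd : ∀ t r, src q ψ t (-r) = -src q ψ t r := hψ.src_odd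
  have hsupp : ∀ s ρ, 0 ≤ s → s + 1 ≤ ρ → src q ψ s ρ = 0 := fun s ρ h => hψ.src_supp hq0 h
  have hbound : ∀ t r, 0 ≤ t → 0 ≤ r → |vel k (src q ψ) t r|
      ≤ (16 + 2 + 4 * q * J + 1 / (2 - q)) * (ε + M ^ q)
        * (r * (1 + (t + r)) ^ (1 - q) * (1 + |t - r|) ^ (-β)) := by
    intro t r ht hr
    have hx : 0 < 1 + (t + r) := by positivity
    have hy1 : (1:ℝ) ≤ 1 + |t - r| := by linarith [abs_nonneg (t - r)]
    rcases le_or_gt (t + 1) r with h1 | h1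
    · rw [vel_supp hk hodd hsupp ht h1, abs_zero]; positivity
    set W := r * (1 + (t + r)) ^ (1 - q) * (1 + |t - r|) ^ (-β) with hW
    have hW0 : 0 ≤ W := by positivity
    have hlin : |k (t + r) - k (t - r)| ≤ 16 * ε * W := hk.abs_sub_le hq'.le hβ1 ht hr
    have hhalf : |t - r| < 1 → (2:ℝ)⁻¹ ≤ (1 + |t - r|) ^ (-β) := fun h => by
      calc (2:ℝ)⁻¹ ≤ (1 + |t - r|)⁻¹ := by gcongr; linarith
        _ = (1 + |t - r|) ^ (-1 : ℝ) := (Real.rpow_neg_one _).symm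
        _ ≤ _ := Real.rpow_le_rpow_of_exponent_le hy1 (by linarith)
    have hexp : (1 + |t - r|) ^ (-(q * s)) ≤ (1 + |t - r|) ^ (-β) :=
      Real.rpow_le_rpow_of_exponent_le hy1 (by linarith)
    have hc : ∀ x, Continuous fun σ => src q ψ σ (x - σ) := fun x =>
      hG.comp (by fun_prop : Continuous fun σ : ℝ => (σ, x - σ))
    have hnl : |(∫ σ in (0:ℝ)..t, src q ψ σ (t + r - σ)) - ∫ σ in (0:ℝ)..t, src q ψ σ (t - r - σ)|
        ≤ (2 + 4 * q * J + 1 / (2 - q)) * M ^ q * W := by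
      rcases le_total r t with hrt | htr
      · have habs : |t - r| = t - r := abs_of_nonneg (by linarith)
        have p1 : |∫ σ in (0:ℝ)..r, src q ψ σ (t + r - σ)| ≤ 2 * M ^ q * W := by
          rcases le_or_gt 1 (t - r) with hy | hy
          · have : ∫ σ in (0:ℝ)..r, src q ψ σ (t + r - σ) = ∫ σ in (0:ℝ)..r, (0:ℝ) :=
              intervalIntegral.integral_congr fun σ hσ => by
                rw [uIcc_of_le hr] at hσ
                exact hsupp σ _ hσ.1 (by linarith [hσ.2])
            rw [this]
            simp only [intervalIntegral.integral_zero, abs_zero]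
            positivity
          · calc _ ≤ 2 * M ^ q * (r * (1 + (t + r)) ^ (1 - q) * 2⁻¹) :=
                  (hψ.abs_integral_incoming_le hM hq0 hs.le hr (by linarith)).trans_eq (by ring)
              _ ≤ _ := by
                  rw [hW]; gcongr; exact hhalf (by rwa [habs])
        have p2 := hψ.abs_integral_shift_le hM hq hq' hJb (y := t - r) (by linarith) hr
        have p3 := hψ.abs_integral_outgoing_le hM hq hq' (a := t - r) (t := t) (y := t - r)
          (by linarith) (by linarith) (by rw [habs]; ring) le_rfl
        have hc' : Continuous fun σ => src q ψ (σ + r) (t - r - σ + r) :=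
          hG.comp (by fun_prop : Continuous fun σ : ℝ => (σ + r, t - r - σ + r))
        have hW' : r * (1 + (t - r + 2 * r)) ^ (1 - q) * (1 + (t - r)) ^ (-β) = W := by
          rw [hW, habs, show t - r + 2 * r = t + r by ring]
        rw [hW', intervalIntegral.integral_sub (hc'.intervalIntegrable _ _)
          ((hc (t - r)).intervalIntegrable _ _)] at p2
        rw [show 2 * t - (t - r) = t + r by ring, sub_sub_cancel] at p3
        have p3' : |∫ σ in (t - r)..t, src q ψ σ (t - r - σ)| ≤ M ^ q / (2 - q) * W :=
          p3.trans (by rw [hW]; gcongr)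
        have e1 : ∫ σ in (0:ℝ)..t, src q ψ σ (t + r - σ)
            = (∫ σ in (0:ℝ)..r, src q ψ σ (t + r - σ))
              + ∫ σ in (0:ℝ)..(t - r), src q ψ (σ + r) (t - r - σ + r) := by
          rw [← intervalIntegral.integral_add_adjacent_intervals
            ((hc (t + r)).intervalIntegrable 0 r) ((hc (t + r)).intervalIntegrable r t)]
          congr 1
          have := intervalIntegral.integral_comp_add_right (a := 0) (b := t - r)
            (fun σ => src q ψ σ (t + r - σ)) r
          rw [zero_add, sub_add_cancel] at this
          rw [← this]
          refine intervalIntegral.integral_congr fun σ _ => ?_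
          congr 1; ring
        have e2 : ∫ σ in (0:ℝ)..t, src q ψ σ (t - r - σ)
            = (∫ σ in (0:ℝ)..(t - r), src q ψ σ (t - r - σ))
              + ∫ σ in (t - r)..t, src q ψ σ (t - r - σ) :=
          (intervalIntegral.integral_add_adjacent_intervals
            ((hc (t - r)).intervalIntegrable _ _) ((hc (t - r)).intervalIntegrable _ _)).symm
        rw [e1, e2]
        have e3 : (2 + 4 * q * J + 1 / (2 - q)) * M ^ q * W
          = 2 * M ^ q * W + 4 * q * J * M ^ q * W + M ^ q / (2 - q) * W := by ring
        rw [abs_le] at *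
        constructor <;> linarith [p1.1, p1.2, p2.1, p2.2, p3'.1, p3'.2]
      · have habs : |t - r| = r - t := by rw [abs_sub_comm, abs_of_nonneg (by linarith)]
        have p1 : |∫ σ in (0:ℝ)..t, src q ψ σ (t + r - σ)| ≤ 2 * M ^ q * W := by
          calc _ ≤ 2 * M ^ q * (t * (1 + (t + r)) ^ (1 - q) * 2⁻¹) :=
                (hψ.abs_integral_incoming_le hM hq0 hs.le ht (by linarith)).trans_eq (by ring)
            _ ≤ _ := by
                rw [hW]; gcongr; exact hhalf (by rw [habs]; linarith)
        have p3 := hψ.abs_integral_outgoing_le hM hq hq' (a := 0) (t := t) (y := t - r)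
          le_rfl ht (by rw [habs]; ring) (by linarith)
        rw [show 2 * t - (t - r) = t + r by ring, sub_zero] at p3
        have p3' : |∫ σ in (0:ℝ)..t, src q ψ σ (t - r - σ)| ≤ M ^ q / (2 - q) * W :=
          p3.trans (by rw [hW]; gcongr)
        have e3 : (2 + 4 * q * J + 1 / (2 - q)) * M ^ q * W
          = 2 * M ^ q * W + 4 * q * J * M ^ q * W + M ^ q / (2 - q) * W := by ring
        have e4 : 0 ≤ 4 * q * J * M ^ q * W := by positivity
        rw [abs_le] at *
        constructor <;> linarith [p1.1, p1.2, p3'.1, p3'.2]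
    have hsplit : vel k (src q ψ) t r = ((k (t + r) - k (t - r))
        + ((∫ σ in (0:ℝ)..t, src q ψ σ (t + r - σ)) - ∫ σ in (0:ℝ)..t, src q ψ σ (t - r - σ))) / 2 := by
      simp only [vel, ray]; ring
    rw [hsplit, abs_div, abs_two]
    have h2 := abs_add_le (k (t + r) - k (t - r))
      ((∫ σ in (0:ℝ)..t, src q ψ σ (t + r - σ)) - ∫ σ in (0:ℝ)..t, src q ψ σ (t - r - σ))
    have h3 : (16 + 2 + 4 * q * J + 1 / (2 - q)) * (ε + M ^ q) * W
        = 16 * ε * W + (2 + 4 * q * J + 1 / (2 - q)) * M ^ q * W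
          + (16 * M ^ q * W + (2 + 4 * q * J + 1 / (2 - q)) * ε * W) := by ring
    have h4 : 0 ≤ 16 * M ^ q * W + (2 + 4 * q * J + 1 / (2 - q)) * ε * W := by positivity
    have h5 : 0 ≤ 16 * ε * W + (2 + 4 * q * J + 1 / (2 - q)) * M ^ q * W := by positivity
    rw [h3]
    linarith
  refine ⟨⟨?_, fun t r _ => vel_neg _ _ t r, fun t r ht hr => vel_supp hk hodd hsupp ht hr,
    fun t r ht hr => (hbound t r ht hr).trans ?_⟩, hbound⟩
  · exact (continuous_vel hk.cont hG).comp
      (by fun_prop : Continuous fun p : ℝ × ℝ => (max p.1 0, p.2))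
  · gcongr
    have h1 : (1 + (t + r)) ^ (1 - q) ≤ 1 :=
      Real.rpow_le_one_of_one_le_of_nonpos (by linarith) (by linarith)
    have h2 : (1 + |t - r|) ^ (-β) ≤ 1 :=
      Real.rpow_le_one_of_one_le_of_nonpos (by linarith [abs_nonneg (t - r)]) (by linarith)
    have h3 : 0 ≤ (1 + (t + r)) ^ (1 - q) := Real.rpow_nonneg (by linarith) _
    calc r * (1 + (t + r)) ^ (1 - q) * (1 + |t - r|) ^ (-β) ≤ r * 1 * 1 := by gcongr
      _ = r := by ring

lemma RadialClass.mono {M M' : ℝ} {ψ : ℝ → ℝ → ℝ} (h : RadialClass M ψ) (hM : M ≤ M') :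
    RadialClass M' ψ :=
  ⟨h.cont, h.odd, h.supp, fun t r ht hr => (h.linear t r ht hr).trans (by gcongr)⟩

lemma WaveClass.mono {s M M' : ℝ} {ψ : ℝ → ℝ → ℝ} (h : WaveClass s M ψ) (hM : M ≤ M') :
    WaveClass s M' ψ :=
  ⟨h.toRadialClass.mono hM, fun t r ht hr => (h.bound t r ht hr).trans (by gcongr),
    fun t r d ht hr hd => (h.lip t r d ht hr hd).trans (by gcongr)⟩

lemma VelClass.mono {q β M M' : ℝ} {p : ℝ → ℝ → ℝ} (h : VelClass q β M p) (hM : M ≤ M') :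
    VelClass q β M' p :=
  ⟨h.toRadialClass.mono hM, fun t r ht hr => (h.bound t r ht hr).trans (by gcongr)⟩

lemma RadialClass.abs_src_sub_le {q M : ℝ} {ψ χ : ℝ → ℝ → ℝ} (hψ : RadialClass M ψ)
    (hχ : RadialClass M χ) (hM : 0 ≤ M) (hM1 : M ≤ 1) (hq : 1 ≤ q) {t : ℝ} (ht : 0 ≤ t) (r : ℝ) :
    |src q ψ t r - src q χ t r| ≤ q * |ψ t r - χ t r| := by
  have h := abs_nl_sub_nl_le hq (hψ.linear_abs ht r) (hχ.linear_abs ht r)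
  rw [src, src, max_eq_left ht]
  refine h.trans ?_
  have : M ^ (q - 1) ≤ 1 := Real.rpow_le_one hM hM1 (by linarith)
  calc q * M ^ (q - 1) * |ψ t r - χ t r| ≤ q * 1 * |ψ t r - χ t r| := by gcongr
    _ = _ := by ring

lemma integral_exp_mul_le {c : ℝ} (hc : 0 < c) (t : ℝ) :
    ∫ s in (0:ℝ)..t, exp (c * s) ≤ exp (c * t) / c := by
  rw [intervalIntegral.integral_comp_mul_left (fun x => exp x) hc.ne', integral_exp, smul_eq_mul,
    mul_zero, Real.exp_zero, div_eq_inv_mul]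
  gcongr
  linarith

section Difference

variable {k : ℝ → ℝ} {G H : ℝ → ℝ → ℝ} {B l : ℝ}

lemma abs_vel_sub_vel_le (hG : Continuous (uncurry G)) (hH : Continuous (uncurry H)) (hl : 0 < l)
    (hB : 0 ≤ B) (hGH : ∀ t r, 0 ≤ t → |G t r - H t r| ≤ B * exp (l * t)) {t : ℝ} (ht : 0 ≤ t)
    (r : ℝ) : |vel k G t r - vel k H t r| ≤ B / l * exp (l * t) := by
  have hray : ∀ x, |(∫ s in (0:ℝ)..t, G s (x - s)) - ∫ s in (0:ℝ)..t, H s (x - s)|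
      ≤ B / l * exp (l * t) := by
    intro x
    have hc : ∀ {F : ℝ → ℝ → ℝ}, Continuous (uncurry F) → Continuous fun s => F s (x - s) :=
      fun {F} hF => hF.comp (by fun_prop : Continuous fun s : ℝ => (s, x - s))
    rw [← intervalIntegral.integral_sub ((hc hG).intervalIntegrable _ _)
      ((hc hH).intervalIntegrable _ _), ← Real.norm_eq_abs]
    calc _ ≤ ∫ s in (0:ℝ)..t, B * exp (l * s) :=
          intervalIntegral.norm_integral_le_of_norm_le ht
            (ae_of_all _ fun s hs => hGH s (x - s) hs.1.le)
            (Continuous.intervalIntegrable (by fun_prop) _ _)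
      _ = B * ∫ s in (0:ℝ)..t, exp (l * s) := intervalIntegral.integral_const_mul _ _
      _ ≤ B * (exp (l * t) / l) := by gcongr; exact integral_exp_mul_le hl t
      _ = _ := by ring
  have h1 := hray (t + r)
  have h2 := hray (t - r)
  simp only [vel, ray]
  rw [abs_le] at *
  constructor <;> linarith [h1.1, h1.2, h2.1, h2.2]

lemma abs_wave_sub_wave_le (hG : Continuous (uncurry G)) (hH : Continuous (uncurry H))
    (hGodd : ∀ s ρ, G s (-ρ) = -G s ρ) (hHodd : ∀ s ρ, H s (-ρ) = -H s ρ) (hl : 1 < l)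
    (hB : 0 ≤ B) (hGH : ∀ t r, 0 ≤ t → |G t r - H t r| ≤ B * exp (l * t)) {t : ℝ} (ht : 0 ≤ t)
    (r : ℝ) : |wave k G t r - wave k H t r| ≤ B / (l - 1) * exp (l * t) := by
  wlog hr : 0 ≤ r generalizing r
  · have := this (-r) (by linarith)
    rwa [wave_neg, wave_neg, neg_sub_neg, abs_sub_comm] at this
  have hl1 : 0 < l - 1 := by linarith
  have hsl : ∀ {F : ℝ → ℝ → ℝ}, Continuous (uncurry F) → ∀ s, Continuous (F s) :=
    fun {F} hF s => hF.comp (by fun_prop : Continuous fun ρ : ℝ => (s, ρ))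
  have hcont : ∀ {F : ℝ → ℝ → ℝ}, Continuous (uncurry F) →
      Continuous fun s => ∫ ρ in |t - r - s|..(t + r - s), F s ρ := fun {F} hF =>
    (((continuous_primitive_param hF).comp (by fun_prop : Continuous fun s : ℝ =>
      (s, t + r - s))).sub ((continuous_primitive_param hF).comp
      (by fun_prop : Continuous fun s : ℝ => (s, |t - r - s|)))).congr fun s =>
        intervalIntegral.integral_interval_sub_left ((hsl hF s).intervalIntegrable _ _)
          ((hsl hF s).intervalIntegrable _ _)
  have key : |∫ s in (0:ℝ)..t, ((∫ ρ in |t - r - s|..(t + r - s), G s ρ)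
      - ∫ ρ in |t - r - s|..(t + r - s), H s ρ)| ≤ 2 * (B / (l - 1) * exp (l * t)) := by
    rw [← Real.norm_eq_abs]
    calc _ ≤ ∫ s in (0:ℝ)..t, 2 * B * exp t * exp ((l - 1) * s) := by
          refine intervalIntegral.norm_integral_le_of_norm_le ht (ae_of_all _ fun s hs => ?_)
            (Continuous.intervalIntegrable (by fun_prop) _ _)
          rw [← intervalIntegral.integral_sub
            ((hsl hG s).intervalIntegrable _ _) ((hsl hH s).intervalIntegrable _ _)]
          refine (intervalIntegral.norm_integral_le_of_norm_le_const fun ρ _ =>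
            hGH s ρ hs.1.le).trans ?_
          have h1 : |t + r - s - (|t - r - s|)| ≤ 2 * exp (t - s) := by
            have : t - s ≤ exp (t - s) := by linarith [Real.add_one_le_exp (t - s)]
            rw [abs_le]
            rcases abs_cases (t - r - s) with ⟨h, _⟩ | ⟨h, _⟩ <;>
              constructor <;> linarith [hs.2]
          calc B * exp (l * s) * |t + r - s - (|t - r - s|)|
              ≤ B * exp (l * s) * (2 * exp (t - s)) := by gcongr
            _ = 2 * B * (exp (l * s) * exp (t - s)) := by ring
            _ = 2 * B * (exp t * exp ((l - 1) * s)) := by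
                rw [← Real.exp_add, ← Real.exp_add]; ring_nf
            _ = _ := by ring
      _ = 2 * B * exp t * ∫ s in (0:ℝ)..t, exp ((l - 1) * s) :=
          intervalIntegral.integral_const_mul _ _
      _ ≤ 2 * B * exp t * (exp ((l - 1) * t) / (l - 1)) := by
          gcongr; exact integral_exp_mul_le hl1 t
      _ = 2 * (B / (l - 1) * (exp t * exp ((l - 1) * t))) := by ring
      _ = _ := by rw [← Real.exp_add]; ring_nf
  rw [wave_eq_domain hG hGodd, wave_eq_domain hH hHodd, add_sub_add_left_eq_sub, ← sub_div,
    ← intervalIntegral.integral_sub ((hcont hG).intervalIntegrable _ _)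
      ((hcont hH).intervalIntegrable _ _), abs_div, abs_two]
  linarith

end Difference

/-- A contraction principle for weighted uniform estimates on `t ≥ 0`. -/
lemma exists_fixedPoint_of_contraction {T : (ℝ → ℝ → ℝ) → ℝ → ℝ → ℝ}
    {K : (ℝ → ℝ → ℝ) → Prop} {w : ℝ → ℝ} {D : ℝ} {ψ₀ : ℝ → ℝ → ℝ}
    (hT : ∀ ψ, K ψ → K (T ψ))
    (hlim : ∀ (u : ℕ → ℝ → ℝ → ℝ) (ψ : ℝ → ℝ → ℝ) (D : ℝ), (∀ n, K (u n)) →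
      (∀ n t r, 0 ≤ t → |u n t r - ψ t r| ≤ D * (1 / 2) ^ n * w t) → K ψ)
    (hcontr : ∀ ψ χ D, K ψ → K χ → 0 ≤ D → (∀ t r, 0 ≤ t → |ψ t r - χ t r| ≤ D * w t) →
      ∀ t r, 0 ≤ t → |T ψ t r - T χ t r| ≤ D / 2 * w t)
    (h₀ : K ψ₀) (hD : 0 ≤ D) (hd : ∀ t r, 0 ≤ t → |T ψ₀ t r - ψ₀ t r| ≤ D * w t) :
    ∃ ψ, K ψ ∧ ∀ t r, 0 ≤ t → T ψ t r = ψ t r := by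
  set u : ℕ → ℝ → ℝ → ℝ := fun n => T^[n] ψ₀ with hu
  have hsucc : ∀ n, u (n + 1) = T (u n) := fun n => Function.iterate_succ_apply' T n ψ₀
  have hK : ∀ n, K (u n) := fun n => by
    induction n with
    | zero => exact h₀
    | succ n ih => rw [hsucc]; exact hT _ ih
  have hdiff : ∀ n t r, 0 ≤ t → |u (n + 1) t r - u n t r| ≤ D * (1 / 2) ^ n * w t := by
    intro n
    induction n with
    | zero => intro t r ht; simpa [hu] using hd t r ht
    | succ n ih =>
      intro t r ht
      have := hcontr _ _ _ (hK (n + 1)) (hK n) (by positivity) ih t r ht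
      rw [← hsucc, ← hsucc] at this
      exact this.trans_eq (by ring)
  have hdist : ∀ t r, 0 ≤ t → ∀ n, dist (u n t r) (u (n + 1) t r) ≤ D * w t * (1 / 2) ^ n :=
    fun t r ht n => by
      rw [dist_comm, Real.dist_eq]; exact (hdiff n t r ht).trans_eq (by ring)
  have hconv : ∀ t r, 0 ≤ t → ∃ a, Tendsto (fun n => u n t r) atTop (𝓝 a) := fun t r ht =>
    cauchySeq_tendsto_of_complete
      (cauchySeq_of_le_geometric (1 / 2) (D * w t) (by norm_num) (hdist t r ht))
  choose! ψ hψ using hconv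
  have hclose : ∀ n t r, 0 ≤ t → |u n t r - ψ t r| ≤ 2 * D * (1 / 2) ^ n * w t := by
    intro n t r ht
    have := dist_le_of_le_geometric_of_tendsto (1 / 2) (D * w t) (by norm_num) (hdist t r ht)
      (hψ t r ht) n
    rw [Real.dist_eq] at this
    exact this.trans_eq (by ring)
  have hKψ := hlim u ψ _ hK hclose
  refine ⟨ψ, hKψ, fun t r ht => ?_⟩
  have h1 : ∀ n, |T ψ t r - ψ t r| ≤ 2 * D * w t * (1 / 2) ^ n := by
    intro n
    have h2 := hcontr _ _ (2 * D * (1 / 2) ^ n) hKψ (hK n) (by positivity) (fun t r ht => by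
      rw [abs_sub_comm]; exact hclose n t r ht) t r ht
    have h3 := hclose (n + 1) t r ht
    rw [hsucc] at h3
    calc |T ψ t r - ψ t r| ≤ |T ψ t r - T (u n) t r| + |T (u n) t r - ψ t r| := abs_sub_le _ _ _
      _ ≤ _ := (add_le_add h2 h3).trans_eq (by ring)
  have h4 : Tendsto (fun n : ℕ => 2 * D * w t * (1 / 2) ^ n) atTop (𝓝 0) := by
    simpa using (tendsto_pow_atTop_nhds_zero_of_lt_one (r := (1 / 2 : ℝ)) (by norm_num)
      (by norm_num)).const_mul (2 * D * w t)
  have h5 := ge_of_tendsto' h4 h1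
  exact sub_eq_zero.1 (abs_nonpos_iff.1 h5)

lemma continuous_of_weighted_limit {X : Type*} [TopologicalSpace X] {f : ℕ → X → ℝ} {g w : X → ℝ}
    {D : ℝ} (hf : ∀ n, Continuous (f n)) (hw : Continuous w) (hw0 : ∀ x, 0 < w x)
    (h : ∀ n x, |f n x - g x| ≤ D * (1 / 2) ^ n * w x) : Continuous g := by
  have h1 : Continuous fun x => g x / w x := by
    refine TendstoUniformly.continuous (F := fun n x => f n x / w x) (p := atTop) ?_
      (Frequently.of_forall fun n => (hf n).div hw fun x => (hw0 x).ne')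
    rw [Metric.tendstoUniformly_iff]
    intro e he
    have h2 : Tendsto (fun n : ℕ => D * (1 / 2 : ℝ) ^ n) atTop (𝓝 0) := by
      simpa using (tendsto_pow_atTop_nhds_zero_of_lt_one (r := (1 / 2 : ℝ)) (by norm_num)
        (by norm_num)).const_mul D
    filter_upwards [h2.eventually_lt_const he] with n hn x
    rw [dist_comm, Real.dist_eq, ← sub_div, abs_div, abs_of_pos (hw0 x)]
    exact ((div_le_iff₀ (hw0 x)).2 (h n x)).trans_lt hn
  refine (h1.mul hw).congr fun x => ?_
  exact div_mul_cancel₀ _ (hw0 x).ne'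

lemma WaveClass.of_weighted_limit {s M D l : ℝ} {u : ℕ → ℝ → ℝ → ℝ} {ψ : ℝ → ℝ → ℝ}
    (hu : ∀ n, WaveClass s M (u n))
    (h : ∀ n t r, 0 ≤ t → |u n t r - ψ t r| ≤ D * (1 / 2) ^ n * exp (l * t)) :
    WaveClass s M ψ := by
  have hlim : ∀ t r, 0 ≤ t → Tendsto (fun n => u n t r) atTop (𝓝 (ψ t r)) := fun t r ht => by
    rw [tendsto_iff_dist_tendsto_zero]
    refine squeeze_zero (fun _ => dist_nonneg) (fun n => h n t r ht) ?_
    simpa using ((tendsto_pow_atTop_nhds_zero_of_lt_one (r := (1 / 2 : ℝ)) (by norm_num)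
      (by norm_num)).const_mul D).mul_const (exp (l * t))
  refine ⟨⟨?_, fun t r ht => ?_, fun t r ht hr => ?_, fun t r ht hr => ?_⟩,
    fun t r ht hr => ?_, fun t r d ht hr hd => ?_⟩
  · exact continuous_of_weighted_limit (w := fun p : ℝ × ℝ => exp (l * max p.1 0))
      (fun n => (hu n).cont) (by fun_prop) (fun _ => exp_pos _)
      fun n p => h n _ p.2 (le_max_right _ _)
  · refine tendsto_nhds_unique (hlim t (-r) ht) ?_
    simpa only [(hu _).odd t r ht] using (hlim t r ht).neg
  · refine tendsto_nhds_unique (hlim t r ht) ?_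
    simp only [(hu _).supp t r ht hr, tendsto_const_nhds]
  · exact le_of_tendsto' (hlim t r ht).abs fun n => (hu n).linear t r ht hr
  · exact le_of_tendsto' (hlim t r ht).abs fun n => (hu n).bound t r ht hr
  · exact le_of_tendsto' ((hlim _ _ (by linarith)).sub (hlim t r ht)).abs
      fun n => (hu n).lip t r d ht hr hd

lemma WaveClass.zero (s : ℝ) {M : ℝ} (hM : 0 ≤ M) : WaveClass s M fun _ _ => 0 := by
  refine ⟨⟨continuous_const, by simp, by simp, fun t r ht hr => ?_⟩, fun t r ht hr => ?_,
    fun t r d ht hr hd => ?_⟩ <;> simp only [sub_self, abs_zero] <;> positivity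

lemma WaveClass.abs_le {s M : ℝ} {ψ : ℝ → ℝ → ℝ} (h : WaveClass s M ψ) (hM : 0 ≤ M) (hs : 0 ≤ s)
    {t : ℝ} (ht : 0 ≤ t) (r : ℝ) : |ψ t r| ≤ M := by
  wlog hr : 0 ≤ r generalizing r
  · have := this (-r) (by linarith)
    rwa [h.odd t r ht, abs_neg] at this
  refine (h.bound t r ht hr).trans ?_
  have h1 : r * (1 + (t + r))⁻¹ ≤ 1 := by
    rw [← div_eq_mul_inv, div_le_one (by linarith)]; linarith
  have h2 : (1 + |t - r|) ^ (-s) ≤ 1 :=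
    Real.rpow_le_one_of_one_le_of_nonpos (by linarith [abs_nonneg (t - r)]) (by linarith)
  calc _ ≤ M * (1 * 1) := by gcongr
    _ = M := by ring

lemma exists_small_rpow_le {c q : ℝ} (hc : 0 < c) (hq : 1 < q) :
    ∃ ε₀ > 0, ∀ ε, 0 ≤ ε → ε ≤ ε₀ → (c * ε) ^ q ≤ ε ∧ c * ε ≤ 1 := by
  have hq1 : 0 < q - 1 := by linarith
  refine ⟨min (c ^ (-q / (q - 1))) c⁻¹, by positivity, fun ε h0 h => ⟨?_, ?_⟩⟩
  · have h1 : ε ^ (q - 1) ≤ c ^ (-q) := by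
      calc ε ^ (q - 1) ≤ (c ^ (-q / (q - 1))) ^ (q - 1) := by
            gcongr; exact h.trans (min_le_left _ _)
        _ = c ^ (-q) := by rw [← Real.rpow_mul hc.le, div_mul_cancel₀ _ hq1.ne']
    have h2 : ε ^ q = ε ^ (q - 1) * ε := by
      rw [← Real.rpow_add_one' h0 (by linarith), sub_add_cancel]
    calc (c * ε) ^ q = c ^ q * (ε ^ (q - 1) * ε) := by rw [Real.mul_rpow hc.le h0, h2]
      _ ≤ c ^ q * (c ^ (-q) * ε) := by gcongr
      _ = ε := by
          rw [← mul_assoc, ← Real.rpow_add hc]; simp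
  · calc c * ε ≤ c * c⁻¹ := by gcongr; exact h.trans (min_le_right _ _)
      _ = 1 := mul_inv_cancel₀ hc.ne'

/-- Small data solutions of the coupled system, in fixed point form. -/
lemma exists_small_solution {q₁ q₂ s β : ℝ} (hq₁ : 1 < q₁) (hq₁' : q₁ < 2) (hq₂ : 1 < q₂)
    (he : 1 + (1 - q₁) * q₂ = -1 - s) (hs : 0 < s) (hβ0 : 0 < β) (hβq : 1 < β * q₂)
    (hβ : (β < 1 ∧ β ≤ q₁ * s) ∨ (β = 1 ∧ 1 < q₁ * s)) :
    ∃ C > 0, ∃ ε₀ > 0, ∀ ε k₁ k₂, ε ≤ ε₀ → NullData ε k₁ → NullData ε k₂ →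
      ∃ ψ, WaveClass s (C * ε) ψ ∧ VelClass q₁ β (C * ε) (vel k₁ (src q₁ ψ)) ∧
        (∀ t r, 0 ≤ t → wave k₂ (src q₂ (vel k₁ (src q₁ ψ))) t r = ψ t r) ∧
        ∀ x t, 0 ≤ t → t ≤ x →
          |ray k₂ (src q₂ (vel k₁ (src q₁ ψ))) x t| ≤ C * ε * (1 + x) ^ (-1 - s) := by
  obtain ⟨CR, hCR, hray⟩ := exists_ray_src_bound (by linarith : 0 < q₂) he hs hβq
  obtain ⟨CA, hCA, hvel⟩ := exists_vel_src_class hq₁ hq₁' hs hβ0 hβ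
  set CS : ℝ := 1 + 1 / s + 3 * 2 ^ s with hCS
  have hCS0 : 0 < CS := by positivity
  set CB : ℝ := max (2 * CR) 1 with hCB
  have hCB0 : 0 < CB := lt_max_of_lt_right one_pos
  obtain ⟨e₁, he₁, hsm₁⟩ := exists_small_rpow_le (c := CS * CB) (by positivity) hq₁
  obtain ⟨e₂, he₂, hsm₂⟩ := exists_small_rpow_le (c := 2 * CA) (by positivity) hq₂
  refine ⟨max (CS * CB) (max (2 * CA) CB), lt_max_of_lt_left (by positivity), min e₁ e₂,
    lt_min he₁ he₂, fun ε k₁ k₂ hεε hk₁ hk₂ => ?_⟩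
  have hε := hk₁.nonneg
  obtain ⟨hM, hM1⟩ := hsm₁ ε hε (hεε.trans (min_le_left _ _))
  obtain ⟨hM', hM1'⟩ := hsm₂ ε hε (hεε.trans (min_le_right _ _))
  set M := CS * CB * ε with hMdef
  set M' := 2 * CA * ε with hMdef'
  have hM0 : 0 ≤ M := by positivity
  have hM0' : 0 ≤ M' := by positivity
  have hV : ∀ ψ, WaveClass s M ψ → VelClass q₁ β M' (vel k₁ (src q₁ ψ)) := fun ψ hψ =>
    (hvel M ε k₁ ψ hM0 hk₁ hψ).mono (by rw [hMdef', mul_comm 2 CA, mul_assoc]; gcongr; linarith)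
  have hR : ∀ ψ, WaveClass s M ψ → ∀ x t, 0 ≤ t → t ≤ x →
      |ray k₂ (src q₂ (vel k₁ (src q₁ ψ))) x t| ≤ CB * ε * (1 + x) ^ (-1 - s) := by
    intro ψ hψ x t ht htx
    refine (hray M' ε k₂ _ hM0' hk₂ (hV ψ hψ) x t ht htx).trans ?_
    have : 0 ≤ 1 + x := by linarith
    gcongr ?_ * _
    calc CR * (ε + M' ^ q₂) ≤ CR * (ε + ε) := by gcongr
      _ = 2 * CR * ε := by ring
      _ ≤ CB * ε := by gcongr; exact le_max_left _ _
  have hεCB : ε ≤ CB * ε := le_mul_of_one_le_left hε (le_max_right _ _)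
  have hW : ∀ ψ, WaveClass s M ψ → WaveClass s M (wave k₂ (src q₂ (vel k₁ (src q₁ ψ)))) := by
    intro ψ hψ
    have hp := hV ψ hψ
    have := waveClass_of_ray_bound hs hk₂ hεCB (hp.continuous_src hM0' (by linarith)) hp.src_odd
      (fun s ρ h => hp.src_supp (by linarith) h) (hR ψ hψ)
    rwa [← mul_assoc] at this
  set l : ℝ := 2 + 2 * q₁ * q₂ with hl
  have hqq : 0 < q₁ * q₂ := by positivity
  have hl0 : 0 < l := by rw [hl]; nlinarith
  have hl1 : 1 < l := by rw [hl]; nlinarith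
  have hcontr : ∀ ψ χ D, WaveClass s M ψ → WaveClass s M χ → 0 ≤ D →
      (∀ t r, 0 ≤ t → |ψ t r - χ t r| ≤ D * exp (l * t)) → ∀ t r, 0 ≤ t →
      |wave k₂ (src q₂ (vel k₁ (src q₁ ψ))) t r - wave k₂ (src q₂ (vel k₁ (src q₁ χ))) t r|
        ≤ D / 2 * exp (l * t) := by
    intro ψ χ D hψ hχ hD hdiff t r ht
    have hcψ := hψ.continuous_src hM0 (by linarith : 0 < q₁)
    have hcχ := hχ.continuous_src hM0 (by linarith : 0 < q₁)
    have h1 : ∀ t r, 0 ≤ t → |src q₁ ψ t r - src q₁ χ t r| ≤ q₁ * D * exp (l * t) :=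
      fun t r ht => (hψ.abs_src_sub_le hχ.toRadialClass hM0 hM1 hq₁.le ht r).trans (by
        rw [mul_assoc]; gcongr; exact hdiff t r ht)
    have h2 := fun t r ht => abs_vel_sub_vel_le (k := k₁) hcψ hcχ hl0 (by positivity) h1 (t := t) ht r
    have hp := hV ψ hψ
    have hp' := hV χ hχ
    have h3 : ∀ t r, 0 ≤ t → |src q₂ (vel k₁ (src q₁ ψ)) t r - src q₂ (vel k₁ (src q₁ χ)) t r|
        ≤ q₂ * (q₁ * D / l) * exp (l * t) :=
      fun t r ht => (hp.abs_src_sub_le hp'.toRadialClass hM0' hM1' hq₂.le ht r).trans (by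
        rw [mul_assoc]; gcongr; exact h2 t r ht)
    refine (abs_wave_sub_wave_le (k := k₂) (hp.continuous_src hM0' (by linarith))
      (hp'.continuous_src hM0' (by linarith)) hp.src_odd hp'.src_odd hl1 (by positivity)
      h3 ht r).trans ?_
    refine mul_le_mul_of_nonneg_right ?_ (exp_pos _).le
    rw [div_le_iff₀ (by linarith), mul_div_assoc', div_le_iff₀ hl0]
    have : q₂ * (q₁ * D) = D / 2 * (2 * q₁ * q₂) := by ring
    rw [this, mul_assoc (D / 2) (l - 1)]
    refine mul_le_mul_of_nonneg_left ?_ (by positivity)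
    rw [hl]
    nlinarith
  have hd : ∀ t r, 0 ≤ t → |wave k₂ (src q₂ (vel k₁ (src q₁ fun _ _ => 0))) t r - 0|
      ≤ M * exp (l * t) := by
    intro t r ht
    rw [sub_zero]
    refine ((hW _ (WaveClass.zero s hM0)).abs_le hM0 hs.le ht r).trans ?_
    exact le_mul_of_one_le_right hM0 (Real.one_le_exp (by positivity))
  obtain ⟨ψ, hψ, hfix⟩ := exists_fixedPoint_of_contraction (D := M)
    (T := fun ψ => wave k₂ (src q₂ (vel k₁ (src q₁ ψ)))) (K := WaveClass s M)
    (w := fun t => exp (l * t)) (ψ₀ := fun _ _ => 0) hW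
    (fun u ψ D hu h => WaveClass.of_weighted_limit hu h) hcontr (WaveClass.zero s hM0) hM0 hd
  refine ⟨ψ, hψ.mono ?_, (hV ψ hψ).mono ?_, hfix, fun x t ht htx => (hR ψ hψ x t ht htx).trans ?_⟩
  · exact mul_le_mul_of_nonneg_right (le_max_left _ _) hε
  · exact mul_le_mul_of_nonneg_right ((le_max_left _ _).trans (le_max_right _ _)) hε
  · have : 0 ≤ 1 + x := by linarith
    gcongr
    exact (le_max_right _ _).trans (le_max_right _ _)

section Data

lemma hasDerivAt_radRep {f : E3 → ℝ} {x : ℝ}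
    (hf : DifferentiableAt ℝ f (x • EuclideanSpace.single (0 : Fin 3) (1 : ℝ))) :
    HasDerivAt (radRep f) (fderiv ℝ f (x • EuclideanSpace.single (0 : Fin 3) (1 : ℝ))
      (EuclideanSpace.single (0 : Fin 3) (1 : ℝ))) x := by
  have h := hf.hasFDerivAt.comp_hasDerivAt x
    ((hasDerivAt_id x).smul_const (EuclideanSpace.single (0 : Fin 3) (1 : ℝ)))
  exact h.congr_deriv (by simp)

lemma contDiff_radRep {f : E3 → ℝ} {n : WithTop ℕ∞} (hf : ContDiff ℝ n f) :
    ContDiff ℝ n (radRep f) :=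
  hf.comp (contDiff_id.smul contDiff_const)

lemma norm_axis (x : ℝ) : ‖x • EuclideanSpace.single (0 : Fin 3) (1 : ℝ)‖ = |x| := by
  simp [norm_smul]

lemma Radial.radRep_neg {f : E3 → ℝ} (hf : Radial f) (x : ℝ) : radRep f (-x) = radRep f x :=
  hf _ _ (by rw [norm_axis, norm_axis, abs_neg])

lemma hasCompactSupport_of_unit_ball {f : E3 → ℝ} (hf : ∀ x, 1 ≤ ‖x‖ → f x = 0) :
    HasCompactSupport f :=
  HasCompactSupport.intro (isCompact_closedBall (0 : E3) 1) fun x hx =>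
    hf x (by simpa using (not_le.1 fun h => hx (by simpa using h)).le)

lemma le_iSup_norm_of_hasCompactSupport {F : Type*} [NormedAddCommGroup F] {f : E3 → F}
    (hf : Continuous f) (hc : HasCompactSupport f) (x : E3) : ‖f x‖ ≤ ⨆ y, ‖f y‖ :=
  le_ciSup (hf.norm.bddAbove_range_of_hasCompactSupport hc.norm) x

lemma abs_radRep_le {f : E3 → ℝ} (hf : Continuous f) (hc : HasCompactSupport f) (x : ℝ) :
    |radRep f x| ≤ ⨆ y, |f y| :=
  le_iSup_norm_of_hasCompactSupport hf hc _

lemma abs_deriv_radRep_le {f : E3 → ℝ} (hf : ContDiff ℝ 1 f) (hc : HasCompactSupport f) (x : ℝ) :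
    |deriv (radRep f) x| ≤ ⨆ y, ‖fderiv ℝ f y‖ := by
  rw [(hasDerivAt_radRep (hf.differentiable one_ne_zero _)).deriv, ← Real.norm_eq_abs]
  refine (ContinuousLinearMap.le_opNorm _ _).trans ?_
  rw [PiLp.norm_single, norm_one, mul_one]
  exact le_iSup_norm_of_hasCompactSupport (hf.continuous_fderiv one_ne_zero) (hc.fderiv ℝ) _

lemma abs_deriv_deriv_radRep_le {f : E3 → ℝ} (hf : ContDiff ℝ 2 f) (hc : HasCompactSupport f)
    (x : ℝ) : |deriv (deriv (radRep f)) x| ≤ ⨆ y, ‖fderiv ℝ (fderiv ℝ f) y‖ := by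
  have hf1 : ContDiff ℝ 1 (fderiv ℝ f) := hf.fderiv_right (by norm_num)
  set e : E3 := EuclideanSpace.single (0 : Fin 3) (1 : ℝ) with he
  have h1 : deriv (radRep f) = fun x => fderiv ℝ f (x • e) e :=
    funext fun x => (hasDerivAt_radRep (hf.differentiable two_ne_zero _)).deriv
  have h2 : HasDerivAt (fun x : ℝ => fderiv ℝ f (x • e) e) (fderiv ℝ (fderiv ℝ f) (x • e) e e) x := by
    have h := (hf1.differentiable one_ne_zero (x • e)).hasFDerivAt.comp_hasDerivAt x
      ((hasDerivAt_id x).smul_const e)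
    simpa using h.clm_apply (hasDerivAt_const x e)
  rw [h1, h2.deriv, ← Real.norm_eq_abs]
  refine (ContinuousLinearMap.le_opNorm₂ _ _ _).trans ?_
  have : ‖e‖ = 1 := by simp [he]
  rw [this, mul_one, mul_one]
  exact le_iSup_norm_of_hasCompactSupport (hf1.continuous_fderiv one_ne_zero)
    ((hc.fderiv ℝ).fderiv ℝ) _

/-- The null derivative `∂_v ψ` at time zero of the free evolution with data `(f₀, f₁)`. -/
def nullData (f₀ f₁ : E3 → ℝ) (x : ℝ) : ℝ :=
  radRep f₀ x + x * deriv (radRep f₀) x + x * radRep f₁ x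

variable {f₀ f₁ : E3 → ℝ}

lemma continuous_nullData (h₀ : ContDiff ℝ 2 f₀) (h₁ : ContDiff ℝ 1 f₁) :
    Continuous (nullData f₀ f₁) := by
  have := (contDiff_radRep h₀).continuous
  have := (contDiff_radRep h₁).continuous
  have := (contDiff_radRep h₀).continuous_deriv (by norm_num)
  unfold nullData
  fun_prop

lemma integral_nullData (h₀ : ContDiff ℝ 2 f₀) (h₁ : ContDiff ℝ 1 f₁) (a b : ℝ) :
    ∫ x in a..b, nullData f₀ f₁ x
      = b * radRep f₀ b - a * radRep f₀ a + ∫ x in a..b, x * radRep f₁ x := by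
  have c₀ := (contDiff_radRep h₀).continuous
  have c₁ := (contDiff_radRep h₁).continuous
  have c₂ := (contDiff_radRep h₀).continuous_deriv (by norm_num)
  unfold nullData
  rw [intervalIntegral.integral_add (Continuous.intervalIntegrable (by fun_prop) _ _)
    (Continuous.intervalIntegrable (by fun_prop) _ _)]
  congr 1
  refine intervalIntegral.integral_eq_sub_of_hasDerivAt (f := fun x => x * radRep f₀ x)
    (fun x _ => ?_) (Continuous.intervalIntegrable (by fun_prop) _ _)
  exact ((hasDerivAt_id x).mul
    (((contDiff_radRep h₀).differentiable two_ne_zero) x).hasDerivAt).congr_deriv (by simp)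

lemma psiLin_eq (h₀ : ContDiff ℝ 2 f₀) (h₁ : ContDiff ℝ 1 f₁) (r₀ : Radial f₀) (r₁ : Radial f₁)
    (t r : ℝ) : psiLin f₀ f₁ t r = (∫ x in (t - r)..(t + r), nullData f₀ f₁ x) / 2 := by
  have c₁ := (contDiff_radRep h₁).continuous
  have hi : ∀ a b, IntervalIntegrable (fun x => x * radRep f₁ x) volume a b := fun a b =>
    Continuous.intervalIntegrable (by fun_prop) a b
  have hodd : ∫ x in (-(t - r))..(t - r), x * radRep f₁ x = 0 :=
    intervalIntegral_odd (fun x => by rw [r₁.radRep_neg]; ring) _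
  have h : ∫ x in (r - t)..(r + t), x * radRep f₁ x = ∫ x in (t - r)..(t + r), x * radRep f₁ x := by
    rw [← intervalIntegral.integral_add_adjacent_intervals (hi (r - t) (t - r)) (hi (t - r) (r + t)),
      ← neg_sub t r, hodd, zero_add, add_comm r t]
  rw [integral_nullData h₀ h₁, psiLin, h, ← neg_sub t r, r₀.radRep_neg, add_comm r t]
  ring

lemma deriv_radRep_eq_zero (h₀ : ContDiff ℝ 1 f₀) (hs : ∀ x, 1 ≤ ‖x‖ → f₀ x = 0) {x : ℝ}
    (hx : 1 ≤ |x|) : deriv (radRep f₀) x = 0 := by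
  have hc := (contDiff_radRep h₀).continuous_deriv le_rfl
  have hcl : IsClosed {x | deriv (radRep f₀) x = 0} := isClosed_eq hc continuous_const
  have ho : {x : ℝ | 1 < |x|} ⊆ {x | deriv (radRep f₀) x = 0} := fun y hy => by
    have hev : radRep f₀ =ᶠ[𝓝 y] fun _ => 0 := by
      filter_upwards [(isOpen_lt continuous_const continuous_abs).mem_nhds hy] with z hz
      exact hs _ (by rw [norm_axis]; exact le_of_lt hz)
    simpa using hev.deriv_eq
  have hmem : x ∈ closure {x : ℝ | 1 < |x|} := by
    have hlim : Tendsto (fun n : ℝ => n * x) (𝓝[>] 1) (𝓝 x) := by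
      have : Tendsto (fun n : ℝ => n * x) (𝓝 1) (𝓝 (1 * x)) := by
        exact (continuous_id.mul continuous_const).tendsto 1
      rw [one_mul] at this
      exact this.mono_left nhdsWithin_le_nhds
    refine mem_closure_of_tendsto hlim ?_
    filter_upwards [self_mem_nhdsWithin] with n hn
    have hn : 1 < n := hn
    change 1 < |n * x|
    rw [abs_mul, abs_of_pos (by linarith)]
    nlinarith
  exact (hcl.closure_subset_iff.2 ho) hmem

lemma nullData_eq_zero (h₀ : ContDiff ℝ 2 f₀) (s₀ : ∀ x, 1 ≤ ‖x‖ → f₀ x = 0)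
    (s₁ : ∀ x, 1 ≤ ‖x‖ → f₁ x = 0) {x : ℝ} (hx : 1 ≤ |x|) : nullData f₀ f₁ x = 0 := by
  have e : ∀ f : E3 → ℝ, (∀ x, 1 ≤ ‖x‖ → f x = 0) → radRep f x = 0 := fun f hf =>
    hf _ (by rwa [norm_axis])
  rw [nullData, e _ s₀, e _ s₁, deriv_radRep_eq_zero (h₀.of_le (by norm_num)) s₀ hx]
  simp

lemma nullData_class {ε : ℝ} (h₀ : ContDiff ℝ 2 f₀) (h₁ : ContDiff ℝ 1 f₁)
    (r₁ : Radial f₁) (s₀ : ∀ x, 1 ≤ ‖x‖ → f₀ x = 0) (s₁ : ∀ x, 1 ≤ ‖x‖ → f₁ x = 0)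
    (hε : W2inf f₀ + W1inf f₁ ≤ ε) : NullData (2 * ε) (nullData f₀ f₁) := by
  have c₀ := hasCompactSupport_of_unit_ball s₀
  have c₁ := hasCompactSupport_of_unit_ball s₁
  have b₀ := abs_radRep_le h₀.continuous c₀
  have b₀' := abs_deriv_radRep_le (h₀.of_le (by norm_num)) c₀
  have b₀'' := abs_deriv_deriv_radRep_le h₀ c₀
  have b₁ := abs_radRep_le h₁.continuous c₁
  have b₁' := abs_deriv_radRep_le h₁ c₁
  rw [W2inf, W1inf] at hε
  have n₀ := (abs_nonneg _).trans (b₀ 0)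
  have n₀' := (abs_nonneg _).trans (b₀' 0)
  have n₀'' := (abs_nonneg _).trans (b₀'' 0)
  have n₁ := (abs_nonneg _).trans (b₁ 0)
  have n₁' := (abs_nonneg _).trans (b₁' 0)
  have hz : ∀ x, 1 ≤ |x| → nullData f₀ f₁ x = 0 := fun x hx => nullData_eq_zero h₀ s₀ s₁ hx
  have hmul : ∀ {x y B : ℝ}, |x| ≤ 1 → |y| ≤ B → |x * y| ≤ B := fun hx hy => by
    rw [abs_mul]
    exact (mul_le_of_le_one_left (abs_nonneg _) hx).trans hy
  have hder : ∀ x, HasDerivAt (nullData f₀ f₁)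
      (deriv (radRep f₀) x + (deriv (radRep f₀) x + x * deriv (deriv (radRep f₀)) x)
        + (radRep f₁ x + x * deriv (radRep f₁) x)) x := fun x => by
    have e₀ := ((contDiff_radRep h₀).differentiable two_ne_zero x).hasDerivAt
    have hd : ContDiff ℝ 1 (deriv (radRep f₀)) := (contDiff_radRep h₀).deriv'
    have e₀' := (hd.differentiable one_ne_zero x).hasDerivAt
    have e₁ := ((contDiff_radRep h₁).differentiable one_ne_zero x).hasDerivAt
    exact ((e₀.add ((hasDerivAt_id x).mul e₀')).add ((hasDerivAt_id x).mul e₁)).congr_deriv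
      (by simp)
  have hdb : ∀ x, |deriv (nullData f₀ f₁) x| ≤ 2 * ε := fun x => by
    rcases le_or_gt |x| 1 with hx | hx
    · rw [(hder x).deriv]
      have a1 := hmul hx (b₀'' x)
      have a2 := hmul hx (b₁' x)
      refine (abs_add_le _ _).trans ?_
      have a3 := abs_add_le (deriv (radRep f₀) x)
        (deriv (radRep f₀) x + x * deriv (deriv (radRep f₀)) x)
      have a4 := abs_add_le (deriv (radRep f₀) x) (x * deriv (deriv (radRep f₀)) x)
      have a5 := abs_add_le (radRep f₁ x) (x * deriv (radRep f₁) x)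
      linarith [b₀' x, b₁ x]
    · have hev : nullData f₀ f₁ =ᶠ[𝓝 x] fun _ => 0 := by
        filter_upwards [(isOpen_lt continuous_const continuous_abs).mem_nhds hx] with z hz'
        exact hz z (le_of_lt hz')
      rw [hev.deriv_eq]
      simp only [deriv_const, abs_zero]
      linarith
  refine ⟨continuous_nullData h₀ h₁, fun x => ?_, fun x y => ?_, hz, ?_⟩
  · rcases le_or_gt |x| 1 with hx | hx
    · have a1 := hmul hx (b₀' x)
      have a2 := hmul hx (b₁ x)
      have a3 := abs_add_le (radRep f₀ x + x * deriv (radRep f₀) x) (x * radRep f₁ x)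
      have a4 := abs_add_le (radRep f₀ x) (x * deriv (radRep f₀) x)
      rw [nullData]
      linarith [b₀ x]
    · rw [hz x hx.le, abs_zero]; linarith
  · simpa only [Real.norm_eq_abs] using convex_univ.norm_image_sub_le_of_norm_deriv_le
      (f := nullData f₀ f₁) (fun z _ => (hder z).differentiableAt) (fun z _ => hdb z)
      (mem_univ y) (mem_univ x)
  · have e : ∀ x, |x| = 1 → radRep f₀ x = 0 := fun x hx => s₀ _ (by rw [norm_axis, hx])
    rw [integral_nullData h₀ h₁, e 1 (by simp), e (-1) (by simp),
      intervalIntegral_odd (fun x => by rw [r₁.radRep_neg]; ring) 1]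
    simp

end Data

lemma mul_sub_le_integral {f : ℝ → ℝ} {a b m : ℝ} (hf : Continuous f) (hab : a ≤ b)
    (h : ∀ x ∈ Icc a b, m ≤ f x) : m * (b - a) ≤ ∫ x in a..b, f x := by
  have := intervalIntegral.integral_mono_on (μ := volume) hab intervalIntegrable_const
    (hf.intervalIntegrable a b) h
  rwa [intervalIntegral.integral_const, smul_eq_mul, mul_comm] at this

section Positivity

variable {k : ℝ → ℝ} {G : ℝ → ℝ → ℝ}

lemma integral_le_integral_along (hG : Continuous (uncurry G)) (hpos : ∀ s ρ, 0 ≤ ρ → 0 ≤ G s ρ)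
    {x t a b : ℝ} (ha : 0 ≤ a) (hab : a ≤ b) (hbt : b ≤ t) (htx : t ≤ x) :
    ∫ σ in a..b, G σ (x - σ) ≤ ∫ σ in (0:ℝ)..t, G σ (x - σ) := by
  have hc : Continuous fun σ => G σ (x - σ) :=
    hG.comp (by fun_prop : Continuous fun σ : ℝ => (σ, x - σ))
  refine intervalIntegral.integral_mono_interval ha hab hbt ?_ (hc.intervalIntegrable _ _)
  filter_upwards [ae_restrict_mem measurableSet_Ioc] with σ hσ
  exact hpos _ _ (by linarith [hσ.2])

lemma integral_le_ray (hG : Continuous (uncurry G)) (hpos : ∀ s ρ, 0 ≤ ρ → 0 ≤ G s ρ)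
    (hk : ∀ x, 1 ≤ x → k x = 0) {x t a b : ℝ} (hx : 1 ≤ x) (ha : 0 ≤ a) (hab : a ≤ b)
    (hbt : b ≤ t) (htx : t ≤ x) : ∫ σ in a..b, G σ (x - σ) ≤ ray k G x t := by
  rw [ray, hk x hx, zero_add]
  exact integral_le_integral_along hG hpos ha hab hbt htx

lemma ray_nonneg (hG : Continuous (uncurry G)) (hpos : ∀ s ρ, 0 ≤ ρ → 0 ≤ G s ρ)
    (hk : ∀ x, 1 ≤ x → k x = 0) {x t : ℝ} (hx : 1 ≤ x) (ht : 0 ≤ t) (htx : t ≤ x) :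
    0 ≤ ray k G x t := by
  simpa using integral_le_ray hG hpos hk hx le_rfl le_rfl ht htx

lemma ray_eq_sub (hG : Continuous (uncurry G)) (hodd : ∀ s ρ, G s (-ρ) = -G s ρ)
    (hk : ∀ x, 1 ≤ x → k x = 0) {y t : ℝ} (hy : 1 ≤ y) :
    ray k G y t = (∫ σ in (0:ℝ)..y, G σ (y - σ)) - ∫ σ in y..t, G σ (σ - y) := by
  have hc : Continuous fun σ => G σ (y - σ) :=
    hG.comp (by fun_prop : Continuous fun σ : ℝ => (σ, y - σ))
  have h : ∀ σ, G σ (σ - y) = -G σ (y - σ) := fun σ => by rw [← hodd, neg_sub]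
  simp only [h, intervalIntegral.integral_neg, sub_neg_eq_add]
  rw [ray, hk y hy, zero_add, intervalIntegral.integral_add_adjacent_intervals
    (hc.intervalIntegrable _ _) (hc.intervalIntegrable _ _)]

lemma le_two_mul_vel (hG : Continuous (uncurry G)) (hodd : ∀ s ρ, G s (-ρ) = -G s ρ)
    (hpos : ∀ s ρ, 0 ≤ ρ → 0 ≤ G s ρ) (hk : ∀ x, 1 ≤ x → k x = 0) {y r : ℝ} (hy : 1 ≤ y)
    (hr : 0 ≤ r) : (∫ σ in y..(y + r), G σ (σ - y)) - (∫ σ in (0:ℝ)..y, G σ (y - σ))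
      ≤ 2 * vel k G (y + r) r := by
  have h1 := ray_nonneg hG hpos hk (x := y + r + r) (t := y + r) (by linarith) (by linarith)
    (by linarith)
  rw [vel, add_sub_cancel_right, ray_eq_sub hG hodd hk hy]
  linarith

lemma wave_zero_right (k : ℝ → ℝ) (G : ℝ → ℝ → ℝ) (t : ℝ) : wave k G t 0 = 0 := by
  have := wave_neg k G t 0
  rw [neg_zero] at this
  linarith

lemma wave_diag (hk : Continuous k) (hG : Continuous (uncurry G))
    (hodd : ∀ s ρ, G s (-ρ) = -G s ρ) (y d : ℝ) :
    wave k G (y + d) d = ∫ τ in (0:ℝ)..d, ray k G (y + 2 * τ) (y + τ) := by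
  have := wave_sub_wave hk hG hodd y 0 d
  rwa [wave_zero_right, sub_zero, zero_add, add_zero] at this

lemma wave_le_wave (hk : Continuous k) (hG : Continuous (uncurry G))
    (hodd : ∀ s ρ, G s (-ρ) = -G s ρ) (hpos : ∀ s ρ, 0 ≤ ρ → 0 ≤ G s ρ)
    (hk1 : ∀ x, 1 ≤ x → k x = 0) {t r d : ℝ} (ht : 0 ≤ t) (hr : 0 ≤ r) (htr : 1 ≤ t + r)
    (hd : 0 ≤ d) : wave k G t r ≤ wave k G (t + d) (r + d) := by
  rw [← sub_nonneg, wave_sub_wave hk hG hodd]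
  refine intervalIntegral.integral_nonneg hd fun τ hτ => ?_
  exact ray_nonneg hG hpos hk1 (by linarith [hτ.1]) (by linarith [hτ.1]) (by linarith [hτ.1])

/-- If the wave vanishes in the interior of the unit light cone then so does its source on the
domain of dependence. -/
lemma source_eq_zero (hk : Continuous k) (hG : Continuous (uncurry G))
    (hodd : ∀ s ρ, G s (-ρ) = -G s ρ) (hpos : ∀ s ρ, 0 ≤ ρ → 0 ≤ G s ρ)
    (hk1 : ∀ x, 1 ≤ x → k x = 0) (h : ∀ y d, 1 ≤ y → 0 ≤ d → wave k G (y + d) d = 0)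
    {t r : ℝ} (ht : 0 ≤ t) (hr : 0 ≤ r) (htr : 1 ≤ t + r) : G t r = 0 := by
  have hx : ray k G (t + r) (t + r) = 0 := by
    refine le_antisymm (not_lt.1 fun hlt => ?_) (ray_nonneg hG hpos hk1 htr (by linarith) le_rfl)
    have hc : Continuous fun τ => ray k G (t + r + 2 * τ) (t + r + τ) :=
      (continuous_ray hk hG).comp (by fun_prop : Continuous fun τ : ℝ => (t + r + 2 * τ, t + r + τ))
    have := intervalIntegral.integral_pos one_pos hc.continuousOn
      (fun τ hτ => ray_nonneg hG hpos hk1 (by linarith [hτ.1]) (by linarith [hτ.1])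
        (by linarith [hτ.1])) ⟨0, by simp, by simpa using hlt⟩
    rw [← wave_diag hk hG hodd, h _ _ htr zero_le_one] at this
    exact this.false
  rw [ray, hk1 _ htr, zero_add] at hx
  refine le_antisymm (not_lt.1 fun hlt => ?_) (hpos _ _ hr)
  have hc : Continuous fun σ => G σ (t + r - σ) :=
    hG.comp (by fun_prop : Continuous fun σ : ℝ => (σ, t + r - σ))
  have := intervalIntegral.integral_pos (a := 0) (b := t + r) (by linarith) hc.continuousOn
    (fun σ hσ => hpos _ _ (by linarith [hσ.2])) ⟨t, ⟨ht, by linarith⟩, by simpa using hlt⟩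
  exact this.ne' hx

end Positivity

lemma src_nonneg (q : ℝ) (ψ : ℝ → ℝ → ℝ) (s ρ : ℝ) (hρ : 0 ≤ ρ) : 0 ≤ src q ψ s ρ :=
  nl_nonneg hρ

lemma src_of_nonneg {q : ℝ} (hq : q ≠ 1) (ψ : ℝ → ℝ → ℝ) {t r : ℝ} (ht : 0 ≤ t) (hr : 0 ≤ r) :
    src q ψ t r = r ^ (1 - q) * |ψ t r| ^ q := by
  rw [src, nl_of_nonneg hq hr, max_eq_left ht]

/-- A lower bound for the source on a strip of outgoing rays makes the velocity grow there. -/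
lemma exists_vel_growth {q c₀ r₀ a b : ℝ} {k : ℝ → ℝ} {ψ : ℝ → ℝ → ℝ} (hq : 1 < q) (hq' : q < 2)
    (hk : ∀ x, 1 ≤ x → k x = 0) (hG : Continuous (uncurry (src q ψ)))
    (hodd : ∀ s ρ, src q ψ s (-ρ) = -src q ψ s ρ) (hc₀ : 0 < c₀) (hr₀ : 0 ≤ r₀) (ha : 1 ≤ a)
    (h : ∀ y ∈ Icc a b, ∀ r, r₀ ≤ r → c₀ ≤ ψ (y + r) r) :
    ∃ c > 0, ∃ r₁ > 0, ∀ y ∈ Icc a b, ∀ r, r₁ ≤ r →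
      c * r ^ (2 - q) ≤ vel k (src q ψ) (y + r) r := by
  have hAc : Continuous fun y => ray (fun _ => 0) (src q ψ) y y :=
    (continuous_ray continuous_const hG).comp (by fun_prop : Continuous fun y : ℝ => (y, y))
  obtain ⟨A, hA⟩ := (isCompact_Icc (a := a) (b := b)).exists_bound_of_continuousOn hAc.continuousOn
  have hlim : Tendsto (fun r : ℝ => c₀ ^ q / 4 * r ^ (2 - q)) atTop atTop :=
    (tendsto_rpow_atTop (by linarith)).const_mul_atTop (by positivity)
  obtain ⟨R, hR⟩ := eventually_atTop.1 (hlim.eventually_ge_atTop A)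
  refine ⟨c₀ ^ q / 8, by positivity, max R (2 * r₀ + 1), lt_max_of_lt_right (by linarith),
    fun y hy r hr => ?_⟩
  have hr1 := (le_max_left _ _).trans hr
  have hr2 := (le_max_right _ _).trans hr
  have hr0 : 0 < r := by linarith
  have hy1 : 1 ≤ y := ha.trans hy.1
  have hAy : ∫ σ in (0:ℝ)..y, src q ψ σ (y - σ) ≤ A := by
    have := hA y hy
    rw [ray, zero_add, Real.norm_eq_abs] at this
    exact (le_abs_self _).trans this
  have hc : Continuous fun σ => src q ψ σ (σ - y) :=
    hG.comp (by fun_prop : Continuous fun σ : ℝ => (σ, σ - y))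
  have h1 : r ^ (1 - q) * c₀ ^ q * (y + r - (y + r / 2)) ≤
      ∫ σ in (y + r / 2)..(y + r), src q ψ σ (σ - y) := by
    refine mul_sub_le_integral hc (by linarith) fun σ hσ => ?_
    have hρ : 0 < σ - y := by linarith [hσ.1]
    rw [src_of_nonneg hq.ne' ψ (by linarith) hρ.le]
    have hψ := h y hy (σ - y) (by linarith [hσ.1])
    rw [add_sub_cancel] at hψ
    have e1 : r ^ (1 - q) ≤ (σ - y) ^ (1 - q) :=
      Real.rpow_le_rpow_of_nonpos hρ (by linarith [hσ.2]) (by linarith)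
    gcongr
    exact hψ.trans (le_abs_self _)
  have h2 : ∫ σ in (y + r / 2)..(y + r), src q ψ σ (σ - y)
      ≤ ∫ σ in y..(y + r), src q ψ σ (σ - y) := by
    refine intervalIntegral.integral_mono_interval (by linarith) (by linarith) le_rfl ?_
      (hc.intervalIntegrable _ _)
    filter_upwards [ae_restrict_mem measurableSet_Ioc] with σ hσ
    exact src_nonneg q ψ _ _ (by linarith [hσ.1])
  have h3 := le_two_mul_vel hG hodd (src_nonneg q ψ) hk hy1 hr0.le
  have h4 := hR r hr1
  have e : r ^ (2 - q) = r ^ (1 - q) * r := by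
    rw [← Real.rpow_add_one hr0.ne']; congr 1; ring
  have e2 : r ^ (1 - q) * c₀ ^ q * (y + r - (y + r / 2)) = c₀ ^ q / 2 * r ^ (2 - q) := by
    rw [e]; ring
  linarith

/-- Growth of the velocity on a strip of outgoing rays bounds the null derivative of the wave from
below inside the light cone. -/
lemma exists_ray_growth {q q₁ s c r₁ a b : ℝ} {k : ℝ → ℝ} {p : ℝ → ℝ → ℝ} (hq : 1 < q)
    (hs : 0 < s) (he : 1 + (1 - q₁) * q = -1 - s)
    (hk : ∀ x, 1 ≤ x → k x = 0) (hG : Continuous (uncurry (src q p)))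
    (hc : 0 < c) (hr₁ : 0 < r₁) (ha : 1 ≤ a) (hab : a < b)
    (h : ∀ y ∈ Icc a b, ∀ r, r₁ ≤ r → c * r ^ (2 - q₁) ≤ p (y + r) r) :
    ∃ c' > 0, ∃ X, ∀ x t, X ≤ x → t ≤ x → b ≤ 2 * t - x →
      c' * x ^ (-1 - s) ≤ ray k (src q p) x t := by
  refine ⟨c ^ q * ((b - a) / 2), by have : 0 < b - a := by linarith
                                    positivity, 2 * r₁ + b, fun x t hx htx hxt => ?_⟩
  have hcx : Continuous fun σ => src q p σ (x - σ) :=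
    hG.comp (by fun_prop : Continuous fun σ : ℝ => (σ, x - σ))
  have h1 : c ^ q * x ^ (-1 - s) * ((x + b) / 2 - (x + a) / 2) ≤
      ∫ σ in ((x + a) / 2)..((x + b) / 2), src q p σ (x - σ) := by
    refine mul_sub_le_integral hcx (by linarith) fun σ hσ => ?_
    have hρ : r₁ ≤ x - σ := by linarith [hσ.2]
    have hρ0 : 0 < x - σ := by linarith
    rw [src_of_nonneg hq.ne' p (by linarith [hσ.1]) hρ0.le]
    have hp := h (2 * σ - x) ⟨by linarith [hσ.1], by linarith [hσ.2]⟩ (x - σ) hρ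
    rw [show 2 * σ - x + (x - σ) = σ by ring] at hp
    calc c ^ q * x ^ (-1 - s) ≤ c ^ q * (x - σ) ^ (-1 - s) := by
          gcongr ?_ * ?_
          exact Real.rpow_le_rpow_of_nonpos hρ0 (by linarith [hσ.1]) (by linarith)
      _ = (x - σ) ^ (1 - q) * (c * (x - σ) ^ (2 - q₁)) ^ q := by
          rw [Real.mul_rpow hc.le (by positivity), ← Real.rpow_mul hρ0.le, mul_left_comm,
            ← Real.rpow_add hρ0, ← he]
          ring_nf
      _ ≤ _ := by gcongr; exact hp.trans (le_abs_self _)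
  have h2 := integral_le_ray hG (src_nonneg q p) hk (x := x) (t := t) (a := (x + a) / 2)
    (b := (x + b) / 2) (by linarith) (by linarith) (by linarith) (by linarith) htx
  calc _ = c ^ q * x ^ (-1 - s) * ((x + b) / 2 - (x + a) / 2) := by ring
    _ ≤ _ := h1.trans h2

/-- Lower bound for a wave far inside the light cone from one for its null derivative. -/
lemma exists_wave_growth {s c b X : ℝ} {k : ℝ → ℝ} {G : ℝ → ℝ → ℝ} (hk : Continuous k)
    (hk1 : ∀ x, 1 ≤ x → k x = 0) (hG : Continuous (uncurry G))
    (hodd : ∀ s ρ, G s (-ρ) = -G s ρ) (hpos : ∀ s ρ, 0 ≤ ρ → 0 ≤ G s ρ) (hc : 0 < c) (hs : 0 < s)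
    (h : ∀ x t, X ≤ x → t ≤ x → b ≤ 2 * t - x → c * x ^ (-1 - s) ≤ ray k G x t) :
    ∃ c' > 0, ∃ y₁ ≥ 1, ∀ y r, y₁ ≤ y → y ≤ r → c' * y ^ (-s) ≤ wave k G (y + r) r := by
  refine ⟨c * 3 ^ (-1 - s), by positivity, max 1 (max b X), le_max_left _ _, fun y r hy hr => ?_⟩
  have hy1 : 1 ≤ y := (le_max_left _ _).trans hy
  have hyb : b ≤ y := (le_max_left _ _).trans ((le_max_right _ _).trans hy)
  have hyX : X ≤ y := (le_max_right _ _).trans ((le_max_right _ _).trans hy)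
  have hcr : Continuous fun τ => ray k G (y + 2 * τ) (y + τ) :=
    (continuous_ray hk hG).comp (by fun_prop : Continuous fun τ : ℝ => (y + 2 * τ, y + τ))
  have h1 : c * (3 * y) ^ (-1 - s) * (y - 0) ≤ ∫ τ in (0:ℝ)..y, ray k G (y + 2 * τ) (y + τ) := by
    refine mul_sub_le_integral hcr (by linarith) fun τ hτ => ?_
    refine le_trans ?_ (h _ _ (by linarith [hτ.1]) (by linarith [hτ.1]) (by linarith))
    gcongr ?_ * ?_
    exact Real.rpow_le_rpow_of_nonpos (by linarith [hτ.1]) (by linarith [hτ.2]) (by linarith)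
  rw [← wave_diag hk hG hodd] at h1
  have h2 := wave_le_wave hk hG hodd hpos hk1 (t := y + y) (r := y) (d := r - y) (by linarith)
    (by linarith) (by linarith) (by linarith)
  rw [add_sub_cancel, show y + y + (r - y) = y + r by ring] at h2
  refine le_trans (le_of_eq ?_) (h1.trans h2)
  rw [Real.mul_rpow (by norm_num) (by linarith), sub_zero, show -s = -1 - s + 1 by ring,
    Real.rpow_add_one (by linarith)]
  ring

section Critical

variable {q s c y₁ M : ℝ} {k : ℝ → ℝ} {ψ : ℝ → ℝ → ℝ}

lemma le_integral_incoming (hq : 1 < q) (hqs : q * s = 1) (hc : 0 < c) (hy₁ : 1 ≤ y₁)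
    (hG : Continuous (uncurry (src q ψ)))
    (h : ∀ y r, y₁ ≤ y → y ≤ r → c * y ^ (-s) ≤ ψ (y + r) r) {Y : ℝ} (hY : 3 * y₁ ≤ Y) :
    c ^ q / 2 * Y ^ (1 - q) * log (Y / 3 / y₁) ≤ ∫ σ in (0:ℝ)..Y, src q ψ σ (Y - σ) := by
  have hYc : Continuous fun σ => src q ψ σ (Y - σ) :=
    hG.comp (by fun_prop : Continuous fun σ : ℝ => (σ, Y - σ))
  have hab : (Y + y₁) / 2 ≤ 2 * Y / 3 := by linarith
  have h1 : ∫ σ in ((Y + y₁) / 2)..(2 * Y / 3), c ^ q * Y ^ (1 - q) * (2 * σ - Y)⁻¹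
      = c ^ q / 2 * Y ^ (1 - q) * log (Y / 3 / y₁) := by
    rw [intervalIntegral.integral_const_mul,
      intervalIntegral.integral_comp_mul_sub (fun z => z⁻¹) two_ne_zero,
      show 2 * ((Y + y₁) / 2) - Y = y₁ by ring, show 2 * (2 * Y / 3) - Y = Y / 3 by ring,
      integral_inv_of_pos (by linarith) (by linarith), smul_eq_mul]
    ring
  rw [← h1]
  refine le_trans ?_ (integral_le_integral_along hG (src_nonneg q ψ) (a := (Y + y₁) / 2)
    (b := 2 * Y / 3) (by linarith) hab (by linarith) le_rfl)
  refine intervalIntegral.integral_mono_on hab ?_ (hYc.intervalIntegrable _ _) fun σ hσ => ?_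
  · refine ContinuousOn.intervalIntegrable_of_Icc hab (ContinuousOn.mul (by fun_prop)
      (ContinuousOn.inv₀ (by fun_prop) fun σ hσ => ?_))
    exact (by linarith [hσ.1] : 0 < 2 * σ - Y).ne'
  · have hy0 : 0 < 2 * σ - Y := by linarith [hσ.1]
    have hρ : 0 < Y - σ := by linarith [hσ.2]
    have hψ := h (2 * σ - Y) (Y - σ) (by linarith [hσ.1]) (by linarith [hσ.2])
    rw [show 2 * σ - Y + (Y - σ) = σ by ring] at hψ
    rw [src_of_nonneg hq.ne' ψ (by linarith) hρ.le]
    have e : (c * (2 * σ - Y) ^ (-s)) ^ q = c ^ q * (2 * σ - Y)⁻¹ := by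
      rw [Real.mul_rpow hc.le (by positivity), ← Real.rpow_mul hy0.le, neg_mul, mul_comm s, hqs,
        Real.rpow_neg_one]
    calc c ^ q * Y ^ (1 - q) * (2 * σ - Y)⁻¹
        = Y ^ (1 - q) * (c * (2 * σ - Y) ^ (-s)) ^ q := by rw [e]; ring
      _ ≤ (Y - σ) ^ (1 - q) * |ψ σ (Y - σ)| ^ q := by
        have : Y ^ (1 - q) ≤ (Y - σ) ^ (1 - q) :=
          Real.rpow_le_rpow_of_nonpos hρ (by linarith) (by linarith)
        gcongr
        exact hψ.trans (le_abs_self _)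

lemma WaveClass.integral_incoming_le_log (hψ : WaveClass s M ψ) (hM : 0 ≤ M) (hq : 1 < q)
    (hqs : q * s = 1) {x : ℝ} (hx : 0 ≤ x) :
    ∫ σ in (0:ℝ)..x, src q ψ σ (x - σ) ≤ M ^ q * (1 + x) ^ (1 - q) * log (1 + x) := by
  have hG := hψ.continuous_src hM (by linarith : 0 < q)
  have hc : Continuous fun σ => src q ψ σ (x - σ) :=
    hG.comp (by fun_prop : Continuous fun σ : ℝ => (σ, x - σ))
  have h1 : ∫ σ in (0:ℝ)..x, M ^ q * (1 + x) ^ (1 - q) * (1 + |2 * σ - x|) ^ (-1 : ℝ)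
      = M ^ q * (1 + x) ^ (1 - q) * log (1 + x) := by
    rw [intervalIntegral.integral_const_mul, integral_incoming_eq hx]
    simp only [Real.rpow_neg_one]
    rw [intervalIntegral.integral_comp_add_left (fun z => z⁻¹), add_zero,
      integral_inv_of_pos one_pos (by linarith), div_one]
  rw [← h1]
  refine intervalIntegral.integral_mono_on hx (hc.intervalIntegrable _ _)
    (Continuous.intervalIntegrable (continuous_const.mul
      (continuous_one_add_abs_rpow (by fun_prop))) _ _) fun σ hσ => ?_
  have := (le_abs_self _).trans
    (hψ.abs_src_le hM (by linarith : 0 < q) hσ.1 (by linarith [hσ.2] : 0 ≤ x - σ))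
  rwa [add_sub_cancel, hqs, show σ - (x - σ) = 2 * σ - x by ring, ← mul_assoc] at this

lemma WaveClass.two_mul_vel_le (hψ : WaveClass s M ψ) (hM : 0 ≤ M) (hq : 1 < q) (hq' : q < 2)
    (hqs : q * s = 1) (hk : ∀ x, 1 ≤ x → k x = 0) {K Y : ℝ} (hK : 1 ≤ K) (hY : 1 ≤ Y) :
    2 * vel k (src q ψ) ((K + 1) * Y / 2) ((K - 1) * Y / 2) ≤
      M ^ q * K ^ (1 - q) * Y ^ (1 - q) * (log (1 + K) + log Y + K / (2 - q))
        - ∫ σ in (0:ℝ)..Y, src q ψ σ (Y - σ) := by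
  have hG := hψ.continuous_src hM (by linarith : 0 < q)
  have hKY : Y ≤ K * Y := le_mul_of_one_le_left (by linarith) hK
  have hq2 : 0 < 2 - q := by linarith
  have h1 : ray k (src q ψ) (K * Y) ((K + 1) * Y / 2)
      ≤ M ^ q * (1 + K * Y) ^ (1 - q) * log (1 + K * Y) := by
    rw [ray, hk _ (by linarith), zero_add]
    refine le_trans ?_ (hψ.integral_incoming_le_log hM hq hqs (by linarith))
    exact integral_le_integral_along hG (src_nonneg q ψ) le_rfl (by linarith) (by linarith) le_rfl
  have h2 := hψ.abs_integral_outgoing_le hM hq hq' (a := Y) (t := (K + 1) * Y / 2) (y := Y)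
    (by linarith) (by linarith) (by rw [abs_of_nonneg (by linarith)]; ring) le_rfl
  have h3 : ∫ σ in Y..((K + 1) * Y / 2), src q ψ σ (σ - Y)
      = -∫ σ in Y..((K + 1) * Y / 2), src q ψ σ (Y - σ) := by
    rw [← intervalIntegral.integral_neg]
    refine intervalIntegral.integral_congr fun σ _ => ?_
    simp only [← hψ.src_odd, neg_sub]
  have h4 := ray_eq_sub hG hψ.src_odd hk (t := (K + 1) * Y / 2) hY
  have e1 : (1 + K * Y) ^ (1 - q) ≤ K ^ (1 - q) * Y ^ (1 - q) := by
    rw [← Real.mul_rpow (by linarith) (by linarith)]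
    exact Real.rpow_le_rpow_of_nonpos (by linarith) (by linarith) (by linarith)
  have e2 : log (1 + K * Y) ≤ log (1 + K) + log Y := by
    rw [← Real.log_mul (by linarith) (by linarith)]
    exact Real.log_le_log (by linarith) (by linarith)
  have e3 : 0 ≤ log (1 + K * Y) := Real.log_nonneg (by linarith)
  have h5 : M ^ q * (1 + K * Y) ^ (1 - q) * log (1 + K * Y)
      ≤ M ^ q * (K ^ (1 - q) * Y ^ (1 - q)) * (log (1 + K) + log Y) := by gcongr
  have h6 : M ^ q / (2 - q) * (((K + 1) * Y / 2 - Y) * (1 + (2 * ((K + 1) * Y / 2) - Y)) ^ (1 - q)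
      * (1 + |Y|) ^ (-(q * s))) ≤ M ^ q / (2 - q) * (K * (K ^ (1 - q) * Y ^ (1 - q))) := by
    rw [hqs, Real.rpow_neg_one, show 2 * ((K + 1) * Y / 2) - Y = K * Y by ring,
      abs_of_nonneg (by linarith : 0 ≤ Y), mul_right_comm]
    have e4 : ((K + 1) * Y / 2 - Y) * (1 + Y)⁻¹ ≤ K := by
      rw [← div_eq_mul_inv, div_le_iff₀ (by linarith)]
      linarith
    gcongr
  rw [vel, show (K + 1) * Y / 2 + (K - 1) * Y / 2 = K * Y by ring,
    show (K + 1) * Y / 2 - (K - 1) * Y / 2 = Y by ring, h4, h3]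
  have h7 := (neg_le_abs _).trans (h2.trans h6)
  have e5 : M ^ q * K ^ (1 - q) * Y ^ (1 - q) * (log (1 + K) + log Y + K / (2 - q))
      = M ^ q * (K ^ (1 - q) * Y ^ (1 - q)) * (log (1 + K) + log Y)
        + M ^ q / (2 - q) * (K * (K ^ (1 - q) * Y ^ (1 - q))) := by ring
  linarith

/-- At the critical exponent, the lower bound for the wave forces a logarithmic loss. -/
lemma WaveClass.exists_le_abs_vel (hψ : WaveClass s M ψ) (hM : 0 ≤ M) (hq : 1 < q) (hq' : q < 2)
    (hqs : q * s = 1) (hk : ∀ x, 1 ≤ x → k x = 0) (hc : 0 < c) (hy₁ : 1 ≤ y₁)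
    (h : ∀ y r, y₁ ≤ y → y ≤ r → c * y ^ (-s) ≤ ψ (y + r) r) :
    ∃ K, 2 ≤ K ∧ ∀ B : ℝ, ∃ Y, 1 ≤ Y ∧
      B * Y ^ (1 - q) ≤ |vel k (src q ψ) ((K + 1) * Y / 2) ((K - 1) * Y / 2)| := by
  have hG := hψ.continuous_src hM (by linarith : 0 < q)
  have hlim : Tendsto (fun K : ℝ => M ^ q * K ^ (-(q - 1))) atTop (𝓝 (M ^ q * 0)) :=
    (tendsto_rpow_neg_atTop (by linarith)).const_mul _
  rw [mul_zero] at hlim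
  have hcq : 0 < c ^ q / 4 := by positivity
  obtain ⟨K, hK2, hK⟩ := ((eventually_ge_atTop 2).and (hlim.eventually_le_const hcq)).exists
  rw [neg_sub] at hK
  refine ⟨K, hK2, fun B => ?_⟩
  have hlog := Real.tendsto_log_atTop.const_mul_atTop hcq
  set D := 2 * B + c ^ q / 4 * (log (1 + K) + K / (2 - q)) + c ^ q / 2 * log (3 * y₁) with hD
  obtain ⟨Y, hYD, hY⟩ := ((hlog.eventually_ge_atTop D).and
    (eventually_ge_atTop (3 * y₁))).exists
  have hY1 : 1 ≤ Y := by linarith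
  have hY0 : 0 < Y ^ (1 - q) := by positivity
  have hq2 : 0 < 2 - q := by linarith
  refine ⟨Y, hY1, ?_⟩
  have h1 := le_integral_incoming hq hqs hc hy₁ hG h hY
  have h2 := hψ.two_mul_vel_le hM hq hq' hqs hk (K := K) (by linarith) hY1
  have h3 : log (Y / 3 / y₁) = log Y - log (3 * y₁) := by
    rw [div_div, Real.log_div (by linarith) (by linarith)]
  have e0 : 0 ≤ log (1 + K) + log Y + K / (2 - q) := by
    have := Real.log_nonneg (by linarith : (1:ℝ) ≤ 1 + K)
    have := Real.log_nonneg hY1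
    positivity
  have h4 : M ^ q * K ^ (1 - q) * Y ^ (1 - q) * (log (1 + K) + log Y + K / (2 - q))
      ≤ c ^ q / 4 * Y ^ (1 - q) * (log (1 + K) + log Y + K / (2 - q)) := by gcongr
  rw [h3] at h1
  have h5 : 2 * B * Y ^ (1 - q) ≤ (c ^ q / 2 * (log Y - log (3 * y₁))
      - c ^ q / 4 * (log (1 + K) + log Y + K / (2 - q))) * Y ^ (1 - q) := by
    gcongr
    linarith
  refine le_trans ?_ (neg_le_abs _)
  linarith

end Critical

lemma jap_half_le (x : ℝ) : jap (x / 2) ≤ 1 + |x| := by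
  rw [jap, Real.sqrt_le_left (by positivity)]
  nlinarith [abs_nonneg x, sq_abs x]

lemma abs_le_jap (x : ℝ) : |x| ≤ jap x := by
  rw [jap, ← Real.sqrt_sq_eq_abs]
  exact Real.sqrt_le_sqrt (by linarith)

lemma jap_pos (x : ℝ) : 0 < jap x := Real.sqrt_pos.2 (by positivity)

lemma weighted_abs_div_le {z r a b e f B : ℝ} (hr : 0 ≤ r) (he : 0 ≤ e) (hf : 0 ≤ f) (hB : 0 ≤ B)
    (h : |z| ≤ B * (r * (1 + |a|) ^ (-e) * (1 + |b|) ^ (-f))) :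
    |z / r| * jap (a / 2) ^ e * jap (b / 2) ^ f ≤ B := by
  rcases hr.eq_or_lt with rfl | hr
  · simpa using hB
  have ha : jap (a / 2) ^ e ≤ (1 + |a|) ^ e :=
    Real.rpow_le_rpow (jap_pos _).le (jap_half_le a) he
  have hb : jap (b / 2) ^ f ≤ (1 + |b|) ^ f :=
    Real.rpow_le_rpow (jap_pos _).le (jap_half_le b) hf
  have ha0 : 0 < 1 + |a| := by positivity
  have hb0 : 0 < 1 + |b| := by positivity
  have hz : |z / r| ≤ B * ((1 + |a|) ^ (-e) * (1 + |b|) ^ (-f)) := by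
    rw [abs_div, abs_of_pos hr, div_le_iff₀ hr]
    linarith
  have := (jap_pos (a / 2)).le
  have := (jap_pos (b / 2)).le
  calc |z / r| * jap (a / 2) ^ e * jap (b / 2) ^ f
      ≤ B * ((1 + |a|) ^ (-e) * (1 + |b|) ^ (-f)) * (1 + |a|) ^ e * (1 + |b|) ^ f := by gcongr
    _ = B * ((1 + |a|) ^ (-e) * (1 + |a|) ^ e) * ((1 + |b|) ^ (-f) * (1 + |b|) ^ f) := by ring
    _ = B := by rw [← Real.rpow_add ha0, ← Real.rpow_add hb0]; simp

lemma WaveClass.weighted_le {s M t r : ℝ} {ψ : ℝ → ℝ → ℝ} (h : WaveClass s M ψ) (hM : 0 ≤ M)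
    (hs : 0 ≤ s) (ht : 0 ≤ t) (hr : 0 ≤ r) :
    |ψ t r / r| * jap ((t + r) / 2) * jap ((t - r) / 2) ^ s ≤ M := by
  have := weighted_abs_div_le hr zero_le_one hs hM (z := ψ t r) (a := t + r) (b := t - r)
    (by rw [abs_of_nonneg (by linarith : 0 ≤ t + r), Real.rpow_neg_one]; exact h.bound t r ht hr)
  rwa [Real.rpow_one] at this

lemma VelClass.weighted_le {q β M t r : ℝ} {p : ℝ → ℝ → ℝ} (h : VelClass q β M p) (hM : 0 ≤ M)
    (hq : 1 < q) (hβ : 0 ≤ β) (ht : 0 ≤ t) (hr : 0 ≤ r) :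
    |p t r / r| * jap ((t + r) / 2) ^ (q - 1) * jap ((t - r) / 2) ^ β ≤ M :=
  weighted_abs_div_le hr (by linarith) hβ hM (by
    rw [abs_of_nonneg (by linarith : 0 ≤ t + r), neg_sub]; exact h.bound t r ht hr)

/-- At the critical exponent the weighted supremum of the velocity is either attained near the
origin, or it is infinite, in which case the real supremum takes its default value. -/
lemma iSup_vel_critical_le {q₁ q₂ s β M ε : ℝ} {k₁ k₂ : ℝ → ℝ} {ψ : ℝ → ℝ → ℝ} (hq₁ : 1 < q₁)
    (hq₁' : q₁ < 2) (hq₂ : 1 < q₂) (he : 1 + (1 - q₁) * q₂ = -1 - s) (hs : 0 < s)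
    (hqs : q₁ * s = 1) (hβ : 0 ≤ β) (hM : 0 ≤ M) (hk₁ : NullData ε k₁)
    (hk₂ : NullData ε k₂) (hψ : WaveClass s M ψ) (hp : VelClass q₁ β M (vel k₁ (src q₁ ψ)))
    (hfix : ∀ t r, 0 ≤ t → wave k₂ (src q₂ (vel k₁ (src q₁ ψ))) t r = ψ t r) :
    (⨆ p : {p : ℝ × ℝ // 0 ≤ p.1 ∧ 0 ≤ p.2}, |vel k₁ (src q₁ ψ) p.1.1 p.1.2 / p.1.2|
      * jap ((p.1.1 + p.1.2) / 2) ^ (q₁ - 1) * jap ((p.1.1 - p.1.2) / 2) ^ (1 : ℝ)) ≤ 2 * M := by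
  have hz : ∀ {k : ℝ → ℝ}, NullData ε k → ∀ x, 1 ≤ x → k x = 0 := fun hk x hx =>
    hk.supp x (hx.trans (le_abs_self x))
  have hG₁ := hψ.continuous_src hM (by linarith : 0 < q₁)
  have hG₂ := hp.continuous_src hM (by linarith : 0 < q₂)
  by_cases h : ∀ y d, 1 ≤ y → 0 ≤ d → wave k₂ (src q₂ (vel k₁ (src q₁ ψ))) (y + d) d = 0
  · refine Real.iSup_le (fun ⟨⟨t, r⟩, ht, hr⟩ => ?_) (by positivity)
    simp only at ht hr ⊢
    rcases le_or_gt 1 (t + r) with htr | htr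
    · have h0 := source_eq_zero hk₂.cont hG₂ hp.src_odd (src_nonneg q₂ _) (hz hk₂) h ht hr htr
      rw [src, nl, max_eq_left ht, mul_eq_zero] at h0
      have : vel k₁ (src q₁ ψ) t r / r = 0 := by
        rcases h0 with h0 | h0
        · rw [h0, div_zero]
        · exact abs_eq_zero.1 ((Real.rpow_eq_zero (abs_nonneg _) (by linarith)).1 h0)
      rw [this, abs_zero, zero_mul, zero_mul]
      positivity
    · have hw := hp.weighted_le hM hq₁ hβ ht hr
      have hu : |t - r| ≤ 1 := by rw [abs_le]; constructor <;> linarith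
      have hj : jap ((t - r) / 2) ^ (1 : ℝ) ≤ 2 * jap ((t - r) / 2) ^ β := by
        rw [Real.rpow_one]
        have h1 : 1 ≤ jap ((t - r) / 2) := by
          rw [jap, Real.one_le_sqrt]
          linarith [sq_nonneg ((t - r) / 2)]
        have h2 := Real.one_le_rpow h1 hβ
        linarith [jap_half_le (t - r)]
      have h0 : 0 ≤ |vel k₁ (src q₁ ψ) t r / r| * jap ((t + r) / 2) ^ (q₁ - 1) :=
        mul_nonneg (abs_nonneg _) (Real.rpow_nonneg (jap_pos _).le _)
      calc _ ≤ |vel k₁ (src q₁ ψ) t r / r| * jap ((t + r) / 2) ^ (q₁ - 1)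
            * (2 * jap ((t - r) / 2) ^ β) := mul_le_mul_of_nonneg_left hj h0
        _ ≤ 2 * M := by linarith
  · push Not at h
    obtain ⟨y₀, r₀, hy₀, hr₀, hne⟩ := h
    set W := wave k₂ (src q₂ (vel k₁ (src q₁ ψ))) with hW
    have hmono : ∀ y r r', 1 ≤ y → 0 ≤ r → r ≤ r' → W (y + r) r ≤ W (y + r') r' := by
      intro y r r' hy hr hrr
      have := wave_le_wave hk₂.cont hG₂ hp.src_odd (src_nonneg q₂ _) (hz hk₂) (t := y + r)
        (r := r) (d := r' - r) (by linarith) hr (by linarith) (by linarith)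
      rwa [add_sub_cancel, show y + r + (r' - r) = y + r' by ring] at this
    have hpos : 0 < W (y₀ + r₀) r₀ := by
      have := hmono y₀ 0 r₀ hy₀ le_rfl hr₀
      rw [hW, wave_zero_right] at this
      exact lt_of_le_of_ne this hne.symm
    have hcW : Continuous fun y => W (y + r₀) r₀ :=
      (continuous_wave hk₂.cont hG₂).comp (by fun_prop : Continuous fun y : ℝ => (y + r₀, r₀))
    obtain ⟨η, hη, hη'⟩ := Metric.eventually_nhds_iff.1
      (hcW.continuousAt.eventually_const_lt (half_lt_self hpos))
    have hstrip : ∀ y ∈ Icc y₀ (y₀ + η / 2), ∀ r, r₀ ≤ r →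
        W (y₀ + r₀) r₀ / 2 ≤ ψ (y + r) r := by
      intro y hy r hr
      rw [← hfix _ _ (by linarith [hy.1])]
      refine le_trans (le_of_lt (hη' ?_)) (hmono y r₀ r (by linarith [hy.1]) hr₀ hr)
      rw [Real.dist_eq, abs_of_nonneg (by linarith [hy.1])]
      linarith [hy.2]
    obtain ⟨c, hc, r₁, hr₁, hv⟩ := exists_vel_growth hq₁ hq₁' (hz hk₁) hG₁ hψ.src_odd
      (half_pos hpos) hr₀ hy₀ hstrip
    obtain ⟨c', hc', X, hX⟩ := exists_ray_growth hq₂ hs he (hz hk₂) hG₂ hc hr₁ hy₀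
      (by linarith) hv
    obtain ⟨c'', hc'', y₁, hy₁, hg⟩ := exists_wave_growth hk₂.cont (hz hk₂) hG₂ hp.src_odd
      (src_nonneg q₂ _) hc' hs hX
    obtain ⟨K, hK, hB⟩ := hψ.exists_le_abs_vel hM hq₁ hq₁' hqs (hz hk₁) hc'' hy₁
      fun y r hy hr => by
        rw [← hfix _ _ (by linarith)]
        exact hg y r hy hr
    rw [Real.iSup_of_not_bddAbove]
    · positivity
    rintro ⟨B, hBB⟩
    obtain ⟨Y, hY, hBY⟩ := hB ((K - 1) * (|B| + 1))
    have hKY : 0 < (K - 1) * Y / 2 := by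
      have : 0 < K - 1 := by linarith
      positivity
    have hQ := hBB ⟨⟨⟨(K + 1) * Y / 2, (K - 1) * Y / 2⟩, by positivity, hKY.le⟩, rfl⟩
    simp only at hQ
    rw [show (K + 1) * Y / 2 + (K - 1) * Y / 2 = K * Y by ring,
      show (K + 1) * Y / 2 - (K - 1) * Y / 2 = Y by ring, Real.rpow_one] at hQ
    have j1 : Y ^ (q₁ - 1) ≤ jap (K * Y / 2) ^ (q₁ - 1) := by
      refine Real.rpow_le_rpow (by linarith) ?_ (by linarith)
      refine le_trans ?_ ((le_abs_self _).trans (abs_le_jap _))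
      nlinarith
    have j2 : Y / 2 ≤ jap (Y / 2) := (le_abs_self _).trans (abs_le_jap _)
    have j3 : 2 * (|B| + 1) * Y ^ (1 - q₁) / Y ≤
        |vel k₁ (src q₁ ψ) ((K + 1) * Y / 2) ((K - 1) * Y / 2) / ((K - 1) * Y / 2)| := by
      rw [abs_div, abs_of_pos hKY, le_div_iff₀ hKY]
      refine le_trans (le_of_eq ?_) hBY
      field_simp
    have j4 : |B| + 1 = 2 * (|B| + 1) * Y ^ (1 - q₁) / Y * Y ^ (q₁ - 1) * (Y / 2) := by
      have : Y ^ (1 - q₁) * Y ^ (q₁ - 1) = 1 := by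
        rw [← Real.rpow_add (by linarith)]; simp
      calc |B| + 1 = (|B| + 1) * (Y ^ (1 - q₁) * Y ^ (q₁ - 1)) := by rw [this, mul_one]
        _ = _ := by field_simp
    have j5 : |B| + 1 ≤ B := by
      have := (jap_pos (K * Y / 2)).le
      rw [j4]
      refine le_trans ?_ hQ
      gcongr
    linarith [le_abs_self B]

lemma wave_nullData_eq {f₀ f₁ : E3 → ℝ} (h₀ : ContDiff ℝ 2 f₀) (h₁ : ContDiff ℝ 1 f₁)
    (r₀ : Radial f₀) (r₁ : Radial f₁) {q : ℝ} (hq : q ≠ 1) {φ χ : ℝ → ℝ → ℝ}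
    (hG : Continuous (uncurry (src q φ))) (hodd : ∀ s ρ, src q φ s (-ρ) = -src q φ s ρ)
    (hχ : ∀ t r, 0 ≤ t → χ t r = φ t r) {t r : ℝ} (ht : 0 ≤ t) (hr : 0 ≤ r) :
    wave (nullData f₀ f₁) (src q φ) t r
      = psiLin f₀ f₁ t r + (1 / 2) * ∫ p in Dreg t r, (p.2 ^ (1 - q) * |χ p.1 p.2| ^ q) := by
  have h : ∫ p in Dreg t r, (p.2 ^ (1 - q) * |χ p.1 p.2| ^ q)
      = ∫ p in Dreg t r, src q φ p.1 p.2 :=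
    setIntegral_congr_fun (isClosed_Dreg t r).measurableSet fun p hp => by
      rw [src_of_nonneg hq φ hp.1 hp.2.2.1, hχ _ _ hp.1]
  rw [h, setIntegral_Dreg hG ht hr, wave_eq_domain hG hodd, psiLin_eq h₀ h₁ r₀ r₁]
  ring

lemma exists_decay_exponent {q₁ q₂ s : ℝ} (hq₂ : 2 < q₂) (hs : 0 < q₁ * s)
    (hcrit : 1 < q₁ * q₂ * s) :
    ∃ β, 0 < β ∧ 1 < β * q₂ ∧ ((β < 1 ∧ β ≤ q₁ * s) ∨ (β = 1 ∧ 1 < q₁ * s)) ∧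
      (q₁ * s = 1 ∨ β = 1 + min 0 (q₁ * s - 1)) := by
  rcases lt_trichotomy (q₁ * s) 1 with h | h | h
  · refine ⟨q₁ * s, hs, by linarith, .inl ⟨h, le_rfl⟩, .inr ?_⟩
    rw [min_eq_right (by linarith)]
    ring
  · exact ⟨1 / 2, by norm_num, by linarith, .inl ⟨by norm_num, by linarith⟩, .inl h⟩
  · refine ⟨1, one_pos, by linarith, .inr ⟨rfl, h⟩, .inr ?_⟩
    rw [min_eq_left (by linarith), add_zero]

lemma Xnorm_le {q₁ q₂ s β M ε : ℝ} {k₁ k₂ : ℝ → ℝ} {ψ : ℝ → ℝ → ℝ} (hq₁ : 1 < q₁)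
    (hq₁' : q₁ < 2) (hq₂ : 1 < q₂) (he : 1 + (1 - q₁) * q₂ = -1 - s) (hs : 0 < s)
    (hβ : 0 ≤ β) (hβ' : q₁ * s = 1 ∨ β = 1 + min 0 (q₁ * s - 1)) (hM : 0 ≤ M)
    (hk₁ : NullData ε k₁) (hk₂ : NullData ε k₂) (hψ : WaveClass s M ψ)
    (hp : VelClass q₁ β M (vel k₁ (src q₁ ψ)))
    (hfix : ∀ t r, 0 ≤ t → wave k₂ (src q₂ (vel k₁ (src q₁ ψ))) t r = ψ t r)
    (hray : ∀ x t, 0 ≤ t → t ≤ x →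
      |ray k₂ (src q₂ (vel k₁ (src q₁ ψ))) x t| ≤ M * (1 + x) ^ (-1 - s)) :
    Xnorm (q₁ - 2) ((q₁ - 2) + min 0 (q₁ * s - 1)) s (wave k₁ (src q₁ ψ))
      (wave k₂ (src q₂ (vel k₁ (src q₁ ψ)))) ≤ 4 * M := by
  have h1 : (⨆ p : {p : ℝ × ℝ // 0 ≤ p.1 ∧ 0 ≤ p.2}, |vel k₁ (src q₁ ψ) p.1.1 p.1.2 / p.1.2|
      * jap ((p.1.1 + p.1.2) / 2) ^ (q₁ - 1)
      * jap ((p.1.1 - p.1.2) / 2) ^ (1 + min 0 (q₁ * s - 1))) ≤ 2 * M := by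
    rcases hβ' with hqs | rfl
    · rw [hqs, sub_self, min_self, add_zero]
      exact iSup_vel_critical_le hq₁ hq₁' hq₂ he hs hqs hβ hM hk₁ hk₂ hψ hp hfix
    · refine Real.iSup_le (fun ⟨⟨t, r⟩, ht, hr⟩ => ?_) (by positivity)
      exact (hp.weighted_le hM hq₁ hβ ht hr).trans (by linarith)
  have h2 : (⨆ p : {p : ℝ × ℝ // 0 ≤ p.1 ∧ 0 ≤ p.2},
      |wave k₂ (src q₂ (vel k₁ (src q₁ ψ))) p.1.1 p.1.2 / p.1.2|
      * jap ((p.1.1 + p.1.2) / 2) * jap ((p.1.1 - p.1.2) / 2) ^ s) ≤ M := by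
    refine Real.iSup_le (fun ⟨⟨t, r⟩, ht, hr⟩ => ?_) hM
    simp only at ht hr ⊢
    rw [hfix t r ht]
    exact hψ.weighted_le hM hs.le ht hr
  have h3 : (⨆ p : {p : ℝ × ℝ // 0 ≤ p.1 ∧ 0 ≤ p.2},
      |ray k₂ (src q₂ (vel k₁ (src q₁ ψ))) (p.1.1 + p.1.2) p.1.1|
      * jap ((p.1.1 + p.1.2) / 2) ^ (s + 1)) ≤ M := by
    refine Real.iSup_le (fun ⟨⟨t, r⟩, ht, hr⟩ => ?_) hM
    simp only at ht hr ⊢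
    have hx : 0 < 1 + (t + r) := by linarith
    have hj : jap ((t + r) / 2) ^ (s + 1) ≤ (1 + (t + r)) ^ (s + 1) := by
      refine Real.rpow_le_rpow (jap_pos _).le ?_ (by linarith)
      simpa only [abs_of_nonneg (by linarith : 0 ≤ t + r)] using jap_half_le (t + r)
    calc _ ≤ M * (1 + (t + r)) ^ (-1 - s) * (1 + (t + r)) ^ (s + 1) :=
          mul_le_mul (hray _ _ ht (by linarith)) hj (Real.rpow_nonneg (jap_pos _).le _)
            (by positivity)
      _ = M := by
        rw [mul_assoc, ← Real.rpow_add hx, show -1 - s + (s + 1) = 0 by ring, Real.rpow_zero,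
          mul_one]
  have hG₁ := hψ.continuous_src hM (by linarith : 0 < q₁)
  have hG₂ := hp.continuous_src hM (by linarith : 0 < q₂)
  rw [Xnorm]
  simp only [pdt_wave hk₁.cont hG₁ hψ.src_odd, pdv_wave hk₂.cont hG₂ hp.src_odd]
  rw [show 1 + (q₁ - 2) = q₁ - 1 by ring,
    show q₁ - 2 + min 0 (q₁ * s - 1) + 1 - (q₁ - 2) = 1 + min 0 (q₁ * s - 1) by ring]
  linarith

/-- Small-data global existence for the Glassey–Strauss system `□φ₁ = |φ₂|^{q₁}`,
`□φ₂ = |∂_tφ₁|^{q₂}` in `ℝ^{3+1}` under spherical symmetry, in the supercritical regime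
`1 < q₁ < 2 < q₂`, `q₁q₂((q₂-2) + q₂(q₁-2)) > 1`: for small radial data supported in the
unit ball there are functions `ψ_i = r·φ_i` solving the Duhamel integral equations, with
`X`-norm bounded by `C·ε`. -/
theorem stmt_8 (q1 q2 : ℝ) (hq1 : 1 < q1) (hq1' : q1 < 2) (hq2 : 2 < q2)
    (hcrit : 1 < q1 * q2 * ((q2 - 2) + q2 * (q1 - 2))) :
    ∃ C : ℝ, 0 < C ∧ ∃ ε : ℝ, 0 < ε ∧
      ∀ φ10 φ20 φ11 φ21 : E3 → ℝ,
        ContDiff ℝ 2 φ10 → ContDiff ℝ 2 φ20 → ContDiff ℝ 1 φ11 → ContDiff ℝ 1 φ21 →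
        Radial φ10 → Radial φ20 → Radial φ11 → Radial φ21 →
        (∀ x : E3, 1 ≤ ‖x‖ → φ10 x = 0 ∧ φ20 x = 0 ∧ φ11 x = 0 ∧ φ21 x = 0) →
        W2inf φ10 + W1inf φ11 ≤ ε → W2inf φ20 + W1inf φ21 ≤ ε →
        ∃ ψ1 ψ2 : ℝ → ℝ → ℝ,
          ContinuousOn (fun p : ℝ × ℝ => ψ1 p.1 p.2) {p : ℝ × ℝ | 0 ≤ p.1 ∧ 0 ≤ p.2} ∧
          ContinuousOn (fun p : ℝ × ℝ => ψ2 p.1 p.2) {p : ℝ × ℝ | 0 ≤ p.1 ∧ 0 ≤ p.2} ∧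
          ContinuousOn (fun p : ℝ × ℝ => pdt ψ1 p.1 p.2) {p : ℝ × ℝ | 0 ≤ p.1 ∧ 0 ≤ p.2} ∧
          ContinuousOn (fun p : ℝ × ℝ => pdv ψ2 p.1 p.2) {p : ℝ × ℝ | 0 ≤ p.1 ∧ 0 ≤ p.2} ∧
          (∀ t r : ℝ, 0 ≤ t → 0 ≤ r →
            ψ1 t r = psiLin φ10 φ11 t r
              + (1 / 2) * ∫ p in Dreg t r, (p.2 ^ (1 - q1) * |ψ2 p.1 p.2| ^ q1)) ∧
          (∀ t r : ℝ, 0 ≤ t → 0 ≤ r →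
            ψ2 t r = psiLin φ20 φ21 t r
              + (1 / 2) * ∫ p in Dreg t r, (p.2 ^ (1 - q2) * |pdt ψ1 p.1 p.2| ^ q2)) ∧
          Xnorm (q1 - 2) ((q1 - 2) + min 0 (q1 * ((q2 - 2) + q2 * (q1 - 2)) - 1))
            ((q2 - 2) + q2 * (q1 - 2)) ψ1 ψ2 ≤ C * ε := by
  set s := (q2 - 2) + q2 * (q1 - 2) with hs_def
  have hqq : 0 < q1 * q2 := by positivity
  have hs : 0 < s := pos_of_mul_pos_right (one_pos.trans hcrit) hqq.le
  have he : 1 + (1 - q1) * q2 = -1 - s := by rw [hs_def]; ring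
  obtain ⟨β, hβ0, hβq, hβ, hβ'⟩ := exists_decay_exponent hq2 (by positivity : 0 < q1 * s) hcrit
  have hq2' : 1 < q2 := by linarith
  obtain ⟨C, hC, ε₀, hε₀, hsol⟩ := exists_small_solution hq1 hq1' hq2' he hs hβ0 hβq hβ
  refine ⟨8 * C, by positivity, ε₀ / 2, by positivity, ?_⟩
  intro φ10 φ20 φ11 φ21 d10 d20 d11 d21 r10 r20 r11 r21 hsupp h1 h2
  have hk₁ := nullData_class d10 d11 r11 (fun x hx => (hsupp x hx).1)
    (fun x hx => (hsupp x hx).2.2.1) h1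
  have hk₂ := nullData_class d20 d21 r21 (fun x hx => (hsupp x hx).2.1)
    (fun x hx => (hsupp x hx).2.2.2) h2
  rw [mul_div_cancel₀ _ two_ne_zero] at hk₁ hk₂
  obtain ⟨ψ, hψ, hp, hfix, hray⟩ := hsol ε₀ _ _ le_rfl hk₁ hk₂
  have hM : 0 ≤ C * ε₀ := by positivity
  have hG₁ := hψ.continuous_src hM (by linarith : 0 < q1)
  have hG₂ := hp.continuous_src hM (by linarith : 0 < q2)
  refine ⟨wave (nullData φ10 φ11) (src q1 ψ),
    wave (nullData φ20 φ21) (src q2 (vel (nullData φ10 φ11) (src q1 ψ))),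
    (continuous_wave hk₁.cont hG₁).continuousOn, (continuous_wave hk₂.cont hG₂).continuousOn,
    ?_, ?_, fun t r ht hr => wave_nullData_eq d10 d11 r10 r11 hq1.ne' hG₁ hψ.src_odd hfix ht hr,
    fun t r ht hr => wave_nullData_eq d20 d21 r20 r21 hq2'.ne' hG₂ hp.src_odd
      (fun t r _ => pdt_wave hk₁.cont hG₁ hψ.src_odd t r) ht hr, ?_⟩
  · simp only [pdt_wave hk₁.cont hG₁ hψ.src_odd]
    exact (continuous_vel hk₁.cont hG₁).continuousOn
  · simp only [pdv_wave hk₂.cont hG₂ hp.src_odd]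
    exact ((continuous_ray hk₂.cont hG₂).comp
      (by fun_prop : Continuous fun p : ℝ × ℝ => (p.1 + p.2, p.1))).continuousOn
  · refine (Xnorm_le hq1 hq1' hq2' he hs hβ0.le hβ' hM hk₁ hk₂ hψ hp hfix hray).trans (le_of_eq ?_)
    ring

end
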